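/- arXiv:0906.5185 — 2 statements merged into one kernel-verified Lean document; each statement's English description precedes it below -/
import Mathlib

section
/- Each operator b̄_ij maps W into W, and the map from the unital C-subalgebra B of End_C(V_1) generated by the operators b̄_ij to W which sends b to b(Σ_{σ∈S_N} ε_σ) is a C-linear isomorphism. In particular, W is a cyclic B-module isomorphic to the regular representation of B. -/
open MvPolynomial

noncomputable section

abbrev Rzl (N : ℕ) := MvPolynomial (Fin N ⊕ Fin N) ℂ

def permHat (N : ℕ) (σ : Equiv.Perm (Fin N)) : Rzl N ≃ₐ[ℂ] Rzl N :=
  renameEquiv ℂ (Equiv.sumCongr σ σ)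

/-- The algebra of multi-symmetric polynomials `P_N`. -/
def PN (N : ℕ) : Subalgebra ℂ (Rzl N) :=
  ⨅ σ : Equiv.Perm (Fin N), AlgHom.equalizer (permHat N σ).toAlgHom (AlgHom.id ℂ (Rzl N))

/-- The automorphism `s_ij^z` exchanging `z_i ↔ z_j` only. -/
def sZ (N : ℕ) (i j : Fin N) : Rzl N ≃ₐ[ℂ] Rzl N :=
  renameEquiv ℂ (Equiv.sumCongr (Equiv.swap i j) (Equiv.refl (Fin N)))

/-- The automorphism `s_ij^λ` exchanging `λ_i ↔ λ_j` only. -/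
def sL (N : ℕ) (i j : Fin N) : Rzl N ≃ₐ[ℂ] Rzl N :=
  renameEquiv ℂ (Equiv.sumCongr (Equiv.refl (Fin N)) (Equiv.swap i j))

/-- The free `ℂ[z,λ]`-module `V_1` with basis `{ε_τ : τ ∈ S_N}`, realized as
functions `S_N → ℂ[z,λ]`. -/
abbrev V1 (N : ℕ) := Equiv.Perm (Fin N) → Rzl N

/-- The left action generator: `T_ij^L (p ε_τ) = s_ij^λ(p) ε_{s_ij τ}`. -/
def TL (N : ℕ) (i j : Fin N) : Module.End ℂ (V1 N) :=
  (LinearMap.compLeft (sL N i j).toLinearMap (Equiv.Perm (Fin N))) ∘ₗ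
    LinearMap.funLeft ℂ (Rzl N) (fun ρ => Equiv.swap i j * ρ)

/-- The right action generator: `T_ij^R (p ε_τ) = s_ij^z(p) ε_{τ s_ij}`. -/
def TR (N : ℕ) (i j : Fin N) : Module.End ℂ (V1 N) :=
  (LinearMap.compLeft (sZ N i j).toLinearMap (Equiv.Perm (Fin N))) ∘ₗ
    LinearMap.funLeft ℂ (Rzl N) (fun ρ => ρ * Equiv.swap i j)

/-- The invariants of the left `S_N`-action on `V_1`. -/
def V1SL (N : ℕ) : Set (V1 N) := {F | ∀ i j : Fin N, i < j → TL N i j F = F}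

/-- The invariants of the right `S_N`-action on `V_1`. -/
def V1SR (N : ℕ) : Set (V1 N) := {F | ∀ i j : Fin N, i < j → TR N i j F = F}

/-- `W = V_1^{S^L} ∩ V_1^{S^R}`. -/
def WW (N : ℕ) : Set (V1 N) := V1SL N ∩ V1SR N


/-- Componentwise multiplication operator on `V_1`. -/
def mulDiag {N : ℕ} (g : Equiv.Perm (Fin N) → Rzl N) : Module.End ℂ (V1 N) where
  toFun F := fun τ => g τ * F τ
  map_add' F G := by funext τ; simp [mul_add]
  map_smul' c F := by funext τ; simp [Pi.smul_apply, mul_smul_comm]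

/-- The shift `ε_τ ↦ ε_{στ}` on `V_1`. -/
def shiftOp {N : ℕ} (σ : Equiv.Perm (Fin N)) : Module.End ℂ (V1 N) :=
  LinearMap.funLeft ℂ (Rzl N) (fun ρ => σ⁻¹ * ρ)

/-- The action `P^B(u,v)` on `V_1` of the universal Bethe polynomial of the
`gl_N` Gaudin model. -/
def PB (N : ℕ) (u v : ℂ) : Module.End ℂ (V1 N) :=
  ((-1 : ℤ) ^ N) • ∑ σ : Equiv.Perm (Fin N), (Equiv.Perm.sign σ : ℤ) •
    (shiftOp σ * mulDiag (fun τ => ∏ i ∈ Finset.univ.filter (fun i => σ i = i),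
        (1 - ((C u : Rzl N) - X (Sum.inl (τ⁻¹ i))) * ((C v : Rzl N) - X (Sum.inr i)))))

section Bethe

open Equiv

variable {N : ℕ}

theorem sum_pow_sub_smul_eq_zero {M : Type*} [AddCommGroup M] [Module ℂ M]
    (x : Fin (N + 1) → M)
    (h : ∀ u : ℂ, u ≠ 0 → ∑ i : Fin (N + 1), u ^ (N - (i : ℕ)) • x i = 0) (i : Fin (N + 1)) :
    x i = 0 := by
  rw [← Module.forall_dual_apply_eq_zero_iff ℂ]
  intro φ
  have key : (∑ i : Fin (N + 1), Polynomial.monomial (N - (i : ℕ)) (φ (x i))) = 0 := by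
    refine Polynomial.eq_zero_of_infinite_isRoot _
      ((Set.finite_singleton (0 : ℂ)).infinite_compl.mono ?_)
    intro u hu
    have := congrArg φ (h u hu)
    simpa [Polynomial.IsRoot, Polynomial.eval_finsetSum, mul_comm] using this
  have h2 := congrArg (fun p => p.coeff (N - (i : ℕ))) key
  simp only [Polynomial.finsetSum_coeff, Polynomial.coeff_monomial, Polynomial.coeff_zero] at h2
  rw [Finset.sum_eq_single i] at h2
  · simpa using h2
  · intro j _ hj
    rw [if_neg]
    intro h3
    apply hj
    ext
    omega
  · simp

theorem sum_sum_pow_sub_smul_eq_zero {M : Type*} [AddCommGroup M] [Module ℂ M]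
    (x : Fin (N + 1) → Fin (N + 1) → M)
    (h : ∀ u v : ℂ, u ≠ 0 → v ≠ 0 → ∑ i : Fin (N + 1), ∑ j : Fin (N + 1),
      (u ^ (N - (i : ℕ)) * v ^ (N - (j : ℕ))) • x i j = 0) (i j : Fin (N + 1)) :
    x i j = 0 := by
  refine sum_pow_sub_smul_eq_zero (x i) (fun v hv => ?_) j
  refine sum_pow_sub_smul_eq_zero
    (fun i => ∑ j : Fin (N + 1), v ^ (N - (j : ℕ)) • x i j) (fun u hu => ?_) i
  simpa [Finset.smul_sum, mul_smul] using h u v hu hv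

/-- The product `∏ (1 - (u - x_i)(v - y_i))` over the fixed points of a permutation. -/
def fixProd {R : Type*} [CommRing R] (u v : R) (x y : Fin N → R) (π : Perm (Fin N)) : R :=
  ∏ i, if π i = i then 1 - (u - x i) * (v - y i) else 1

theorem fixProd_mul_swap_sub {R : Type*} [CommRing R] (u v : R) (x y : Fin N → R)
    (π : Perm (Fin N)) {k j : Fin N} (hkj : k ≠ j) :
    fixProd u v x y (π * swap k j) - fixProd u v (x ∘ swap k j) y (swap k j * π) =
      (y k - y j) * fixProd u v x y π *
        ((if π j = k then u - x k else 0) - (if π k = j then u - x j else 0)) := by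
  have split : ∀ g : Fin N → R,
      ∏ i, g i = g k * g j * ∏ i ∈ (Finset.univ.erase k).erase j, g i := by
    intro g
    rw [mul_assoc, Finset.mul_prod_erase _ _ (by simp [hkj.symm]),
      Finset.mul_prod_erase _ _ (by simp)]
  have h1 : ∀ i ∈ (Finset.univ.erase k).erase j,
      (if (π * swap k j) i = i then 1 - (u - x i) * (v - y i) else 1) =
      (if π i = i then 1 - (u - x i) * (v - y i) else 1) := by
    intro i hi
    simp only [Finset.mem_erase, Finset.mem_univ, and_true] at hi
    rw [Perm.mul_apply, swap_apply_of_ne_of_ne hi.2 hi.1]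
  have h2 : ∀ i ∈ (Finset.univ.erase k).erase j,
      (if (swap k j * π) i = i then 1 - (u - (x ∘ swap k j) i) * (v - y i) else 1) =
      (if π i = i then 1 - (u - x i) * (v - y i) else 1) := by
    intro i hi
    simp only [Finset.mem_erase, Finset.mem_univ, and_true] at hi
    have : (swap k j * π) i = i ↔ π i = i := by
      rw [Perm.mul_apply, ← swap_apply_of_ne_of_ne hi.2 hi.1, swap_apply_of_ne_of_ne hi.2 hi.1]
      constructor
      · intro h
        have := congrArg (swap k j) h
        rwa [swap_apply_self, swap_apply_of_ne_of_ne hi.2 hi.1] at this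
      · intro h
        rw [h, swap_apply_of_ne_of_ne hi.2 hi.1]
    simp only [this, Function.comp, swap_apply_of_ne_of_ne hi.2 hi.1]
  have e1 : (swap k j) (π k) = k ↔ π k = j := by
    rw [swap_apply_eq_iff, swap_apply_left]
  have e2 : (swap k j) (π j) = j ↔ π j = k := by
    rw [swap_apply_eq_iff, swap_apply_right]
  unfold fixProd
  rw [split, split, split, Finset.prod_congr rfl h1, Finset.prod_congr rfl h2]
  simp only [Perm.mul_apply, swap_apply_left, swap_apply_right, Function.comp, e1, e2]
  have n1 : π k = j → π k ≠ k := fun h h' => hkj (h'.symm.trans h)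
  have n2 : π j = k → π j ≠ j := fun h h' => hkj (h.symm.trans h')
  have n3 : π j = k → π k ≠ k := fun h h' => hkj (π.injective (h'.trans h.symm))
  have n4 : π k = j → π j ≠ j := fun h h' => hkj (π.injective (h.trans h'.symm))
  by_cases c1 : π j = k <;> by_cases c2 : π k = j
  · rw [if_neg (n1 c2), if_neg (n2 c1)]
    simp only [c1, c2, if_true]
    ring
  · rw [if_neg (n3 c1), if_neg (n2 c1)]
    simp only [c1, c2, if_true, if_false]
    ring
  · rw [if_neg (n1 c2), if_neg (n4 c2)]
    simp only [c1, c2, if_true, if_false]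
    ring
  · simp only [c1, c2, if_false]
    ring

theorem sum_mul_fixProd_sub {R : Type*} [CommRing R] (u v : R) (x y : Fin N → R)
    (π : Perm (Fin N)) (k : Fin N) :
    ∑ j ∈ Finset.univ.erase k, (∏ l ∈ (Finset.univ.erase k).erase j, (y k - y l)) *
      (fixProd u v x y (π * swap k j) - fixProd u v (x ∘ swap k j) y (swap k j * π)) =
    (∏ l ∈ Finset.univ.erase k, (y k - y l)) * (x (π k) - x k) * fixProd u v x y π := by
  have h1 : ∀ j ∈ Finset.univ.erase k, (∏ l ∈ (Finset.univ.erase k).erase j, (y k - y l)) *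
      (fixProd u v x y (π * swap k j) - fixProd u v (x ∘ swap k j) y (swap k j * π)) =
      (∏ l ∈ Finset.univ.erase k, (y k - y l)) * fixProd u v x y π *
        ((if π⁻¹ k = j then u - x k else 0) - (if π k = j then u - x j else 0)) := by
    intro j hj
    have hkj : k ≠ j := by simpa [eq_comm] using hj
    rw [fixProd_mul_swap_sub u v x y π hkj, ← Finset.mul_prod_erase _ _ hj]
    have : π j = k ↔ π⁻¹ k = j := by rw [Perm.inv_eq_iff_eq, eq_comm]
    simp only [this]
    ring
  rw [Finset.sum_congr rfl h1, ← Finset.mul_sum, Finset.sum_sub_distrib, Finset.sum_ite_eq,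
    Finset.sum_ite_eq]
  have : π⁻¹ k = k ↔ π k = k := by rw [Perm.inv_eq_iff_eq, eq_comm]
  by_cases c : π k = k
  · simp [c, this.2 c]
  · simp only [Finset.mem_erase, Finset.mem_univ, and_true, ne_eq, this, c, not_false_iff, if_true]
    ring

theorem PB_apply (u v : ℂ) (F : V1 N) (τ : Perm (Fin N)) :
    PB N u v F τ = (-1) ^ N * ∑ σ : Perm (Fin N), (Perm.sign σ : ℤ) *
      (fixProd (C u) (C v) (fun i => X (Sum.inl (τ⁻¹ i))) (fun i => X (Sum.inr i)) σ *
        F (σ⁻¹ * τ)) := by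
  have h : ∀ σ : Perm (Fin N),
      (∏ i ∈ Finset.univ.filter (fun i => σ i = i), (1 - ((C u : Rzl N) -
        X (Sum.inl ((σ⁻¹ * τ)⁻¹ i))) * ((C v : Rzl N) - X (Sum.inr i)))) =
      fixProd (C u) (C v) (fun i => X (Sum.inl (τ⁻¹ i))) (fun i => X (Sum.inr i)) σ := by
    intro σ
    rw [fixProd, Finset.prod_filter]
    refine Finset.prod_congr rfl fun i _ => ?_
    split_ifs with hi
    · rw [mul_inv_rev, inv_inv, Perm.mul_apply, hi]
    · rfl
  simp only [PB, LinearMap.smul_apply, LinearMap.sum_apply, Module.End.mul_apply, shiftOp, mulDiag,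
    LinearMap.funLeft_apply, Pi.smul_apply, Finset.sum_apply, LinearMap.coe_mk, AddHom.coe_mk, h]
  simp [zsmul_eq_mul]

/-- The Gaudin-type Hamiltonians commuting with the Bethe algebra, cleared of denominators. -/
def gaudin (k : Fin N) : Module.End ℂ (V1 N) where
  toFun F := fun τ =>
    (∏ l ∈ Finset.univ.erase k, ((X (Sum.inr k) : Rzl N) - X (Sum.inr l))) *
      X (Sum.inl (τ⁻¹ k)) * F τ +
    ∑ j ∈ Finset.univ.erase k,
      (∏ l ∈ (Finset.univ.erase k).erase j, ((X (Sum.inr k) : Rzl N) - X (Sum.inr l))) *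
      F (swap k j * τ)
  map_add' F G := by
    funext τ
    simp only [Pi.add_apply, mul_add, Finset.sum_add_distrib]
    ring
  map_smul' c F := by
    funext τ
    simp only [Pi.smul_apply, mul_smul_comm, ← Finset.smul_sum, ← smul_add, RingHom.id_apply]

theorem gaudin_apply (k : Fin N) (F : V1 N) (τ : Perm (Fin N)) :
    gaudin k F τ =
    (∏ l ∈ Finset.univ.erase k, ((X (Sum.inr k) : Rzl N) - X (Sum.inr l))) *
      X (Sum.inl (τ⁻¹ k)) * F τ +
    ∑ j ∈ Finset.univ.erase k,
      (∏ l ∈ (Finset.univ.erase k).erase j, ((X (Sum.inr k) : Rzl N) - X (Sum.inr l))) *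
      F (swap k j * τ) := rfl

theorem sum_fixProd_gaudin_comm {R : Type*} [CommRing R] (u v : R) (x y : Fin N → R)
    (F : Perm (Fin N) → R) (τ : Perm (Fin N)) (k : Fin N) :
    ∑ σ : Perm (Fin N), ((Perm.sign σ : ℤ) : R) * (fixProd u v x y σ *
      ((∏ l ∈ Finset.univ.erase k, (y k - y l)) * x (σ k) * F (σ⁻¹ * τ) +
        ∑ j ∈ Finset.univ.erase k, (∏ l ∈ (Finset.univ.erase k).erase j, (y k - y l)) *
          F (swap k j * (σ⁻¹ * τ)))) =
    (∏ l ∈ Finset.univ.erase k, (y k - y l)) * x k *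
        ∑ σ : Perm (Fin N), ((Perm.sign σ : ℤ) : R) * (fixProd u v x y σ * F (σ⁻¹ * τ)) +
      ∑ j ∈ Finset.univ.erase k, (∏ l ∈ (Finset.univ.erase k).erase j, (y k - y l)) *
        ∑ σ : Perm (Fin N), ((Perm.sign σ : ℤ) : R) *
          (fixProd u v (x ∘ swap k j) y σ * F (σ⁻¹ * (swap k j * τ))) := by
  have r1 : ∀ j ∈ Finset.univ.erase k, ∑ σ : Perm (Fin N), ((Perm.sign σ : ℤ) : R) *
      (fixProd u v x y σ * F (swap k j * (σ⁻¹ * τ))) =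
      ∑ σ : Perm (Fin N), -((Perm.sign σ : ℤ) : R) *
      (fixProd u v x y (σ * swap k j) * F (σ⁻¹ * τ)) := by
    intro j hj
    have hkj : k ≠ j := by simpa [eq_comm] using hj
    rw [← Equiv.sum_comp (Equiv.mulRight (swap k j))]
    refine Finset.sum_congr rfl fun σ _ => ?_
    simp [Perm.sign_mul, Perm.sign_swap hkj, mul_assoc]
  have r2 : ∀ j ∈ Finset.univ.erase k, ∑ σ : Perm (Fin N), ((Perm.sign σ : ℤ) : R) *
      (fixProd u v (x ∘ swap k j) y σ * F (σ⁻¹ * (swap k j * τ))) =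
      ∑ σ : Perm (Fin N), -((Perm.sign σ : ℤ) : R) *
      (fixProd u v (x ∘ swap k j) y (swap k j * σ) * F (σ⁻¹ * τ)) := by
    intro j hj
    have hkj : k ≠ j := by simpa [eq_comm] using hj
    rw [← Equiv.sum_comp (Equiv.mulLeft (swap k j))]
    refine Finset.sum_congr rfl fun σ _ => ?_
    simp [Perm.sign_mul, Perm.sign_swap hkj, mul_assoc]
  have L : ∑ σ : Perm (Fin N), ((Perm.sign σ : ℤ) : R) * (fixProd u v x y σ *
        ∑ j ∈ Finset.univ.erase k, (∏ l ∈ (Finset.univ.erase k).erase j, (y k - y l)) *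
          F (swap k j * (σ⁻¹ * τ))) =
      ∑ σ : Perm (Fin N), ((Perm.sign σ : ℤ) : R) * F (σ⁻¹ * τ) *
        (- ∑ j ∈ Finset.univ.erase k, (∏ l ∈ (Finset.univ.erase k).erase j, (y k - y l)) *
          fixProd u v x y (σ * swap k j)) := by
    calc _ = ∑ j ∈ Finset.univ.erase k, (∏ l ∈ (Finset.univ.erase k).erase j, (y k - y l)) *
          ∑ σ : Perm (Fin N), ((Perm.sign σ : ℤ) : R) *
          (fixProd u v x y σ * F (swap k j * (σ⁻¹ * τ))) := by
          simp only [Finset.mul_sum]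
          rw [Finset.sum_comm]
          exact Finset.sum_congr rfl fun σ _ => Finset.sum_congr rfl fun j _ => by ring
      _ = _ := by
          rw [Finset.sum_congr rfl fun j hj => by rw [r1 j hj]]
          simp only [Finset.mul_sum, ← Finset.sum_neg_distrib]
          rw [Finset.sum_comm]
          exact Finset.sum_congr rfl fun σ _ => Finset.sum_congr rfl fun j _ => by ring
  have Rr : ∑ j ∈ Finset.univ.erase k, (∏ l ∈ (Finset.univ.erase k).erase j, (y k - y l)) *
      ∑ σ : Perm (Fin N), ((Perm.sign σ : ℤ) : R) *
      (fixProd u v (x ∘ swap k j) y σ * F (σ⁻¹ * (swap k j * τ))) =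
      ∑ σ : Perm (Fin N), ((Perm.sign σ : ℤ) : R) * F (σ⁻¹ * τ) *
        (- ∑ j ∈ Finset.univ.erase k, (∏ l ∈ (Finset.univ.erase k).erase j, (y k - y l)) *
          fixProd u v (x ∘ swap k j) y (swap k j * σ)) := by
    rw [Finset.sum_congr rfl fun j hj => by rw [r2 j hj]]
    simp only [Finset.mul_sum, ← Finset.sum_neg_distrib]
    rw [Finset.sum_comm]
    exact Finset.sum_congr rfl fun σ _ => Finset.sum_congr rfl fun j _ => by ring
  simp only [mul_add, Finset.sum_add_distrib]
  rw [L, Rr, Finset.mul_sum, ← Finset.sum_add_distrib, ← Finset.sum_add_distrib]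
  refine Finset.sum_congr rfl fun σ _ => ?_
  have key := sum_mul_fixProd_sub u v x y σ k
  simp only [mul_sub (∏ l ∈ (Finset.univ.erase k).erase _, _), Finset.sum_sub_distrib] at key
  linear_combination (-((Perm.sign σ : ℤ) : R) * F (σ⁻¹ * τ)) * key

theorem PB_commute_gaudin (u v : ℂ) (k : Fin N) :
    PB N u v * gaudin k = gaudin k * PB N u v := by
  refine LinearMap.ext fun F => funext fun τ => ?_
  simp only [Module.End.mul_apply]
  rw [gaudin_apply, PB_apply]
  simp only [PB_apply, gaudin_apply, mul_left_comm _ ((-1 : Rzl N) ^ N), ← Finset.mul_sum,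
    ← mul_add]
  congr 1
  have hsw : ∀ j : Fin N, (fun i => (X (Sum.inl ((swap k j * τ)⁻¹ i)) : Rzl N)) =
      (fun i => X (Sum.inl (τ⁻¹ i))) ∘ swap k j := by
    intro j
    funext i
    simp
  have hxs : ∀ σ : Perm (Fin N), (σ⁻¹ * τ)⁻¹ k = τ⁻¹ (σ k) := by
    intro σ
    simp
  simp only [hsw, hxs]
  exact sum_fixProd_gaudin_comm (C u) (C v) (fun i => (X (Sum.inl (τ⁻¹ i)) : Rzl N))
    (fun i => X (Sum.inr i)) F τ k

theorem TL_apply (i j : Fin N) (F : V1 N) (τ : Perm (Fin N)) :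
    TL N i j F τ = rename (Sum.map id (swap i j)) (F (swap i j * τ)) := rfl

theorem TR_apply (i j : Fin N) (F : V1 N) (τ : Perm (Fin N)) :
    TR N i j F τ = rename (Sum.map (swap i j) id) (F (τ * swap i j)) := rfl

theorem rename_fixProd (u v : ℂ) (f : Fin N ⊕ Fin N → Fin N ⊕ Fin N)
    (x y : Fin N → Rzl N) (π : Perm (Fin N)) :
    rename f (fixProd (C u) (C v) x y π) =
      fixProd (C u) (C v) (fun i => rename f (x i)) (fun i => rename f (y i)) π := by
  simp [fixProd, map_prod, apply_ite (rename f)]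

theorem fixProd_conj {R : Type*} [CommRing R] (u v : R) (x y : Fin N → R)
    (s π : Perm (Fin N)) :
    fixProd u v x y (s * π * s⁻¹) = fixProd u v (x ∘ s) (y ∘ s) π := by
  rw [fixProd, fixProd, ← Equiv.prod_comp s]
  simp

theorem PB_commute_TL (u v : ℂ) (i j : Fin N) :
    PB N u v * TL N i j = TL N i j * PB N u v := by
  refine LinearMap.ext fun F => funext fun τ => ?_
  simp only [Module.End.mul_apply]
  rw [TL_apply, PB_apply, PB_apply, map_mul, map_sum, map_pow, map_neg, map_one,
    ← Equiv.sum_comp (MulAut.conj (swap i j)).toEquiv]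
  congr 1
  refine Finset.sum_congr rfl fun σ _ => ?_
  rw [map_mul, map_mul, map_intCast, rename_fixProd]
  simp only [TL_apply, MulEquiv.toEquiv_eq_coe, EquivLike.coe_coe, MulAut.conj_apply, fixProd_conj]
  have hs : Perm.sign (swap i j * σ * (swap i j)⁻¹) = Perm.sign σ := by
    rw [map_mul, map_mul, mul_right_comm, ← map_mul, mul_inv_cancel, map_one, one_mul]
  rw [hs]
  simp [mul_assoc, Function.comp_def]

theorem PB_commute_TR (u v : ℂ) (i j : Fin N) :
    PB N u v * TR N i j = TR N i j * PB N u v := by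
  refine LinearMap.ext fun F => funext fun τ => ?_
  simp only [Module.End.mul_apply]
  rw [TR_apply, PB_apply, PB_apply, map_mul, map_sum, map_pow, map_neg, map_one]
  congr 1
  refine Finset.sum_congr rfl fun σ _ => ?_
  rw [map_mul, map_mul, map_intCast, rename_fixProd]
  simp [TR_apply, mul_assoc]

theorem PB_commute_mulDiag_const (u v : ℂ) (r : Rzl N) :
    PB N u v * mulDiag (fun _ => r) = mulDiag (fun _ => r) * PB N u v := by
  refine LinearMap.ext fun F => funext fun τ => ?_
  simp only [Module.End.mul_apply, PB_apply, mulDiag, LinearMap.coe_mk, AddHom.coe_mk,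
    Finset.mul_sum]
  exact Finset.sum_congr rfl fun σ _ => by ring

/-- An operator commuting with all values of a polynomial commutes with its coefficients. -/
theorem commute_coeff {bb : Fin (N + 1) → Fin (N + 1) → Module.End ℂ (V1 N)}
    (hb : ∀ u v : ℂ, PB N u v =
      ∑ i : Fin (N + 1), ∑ j : Fin (N + 1),
        (u ^ (N - (i : ℕ)) * v ^ (N - (j : ℕ))) • bb i j)
    {T : Module.End ℂ (V1 N)} (hT : ∀ u v, PB N u v * T = T * PB N u v) (i j : Fin (N + 1)) :
    bb i j * T = T * bb i j := by
  have := sum_sum_pow_sub_smul_eq_zero (fun i j => bb i j * T - T * bb i j) (fun u v _ _ => ?_) i j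
  · exact sub_eq_zero.1 this
  · have := hT u v
    rw [hb, ← sub_eq_zero] at this
    simpa only [Finset.sum_mul, Finset.mul_sum, smul_mul_assoc, mul_smul_comm,
      ← Finset.sum_sub_distrib, smul_sub] using this

theorem apply_eq_sum_single {x : Module.End ℂ (V1 N)}
    (hx : ∀ r : Rzl N, x * mulDiag (fun _ => r) = mulDiag (fun _ => r) * x)
    (F : V1 N) (τ : Perm (Fin N)) :
    x F τ = ∑ ρ, F ρ * x (Pi.single ρ 1) τ := by
  have h1 : F = ∑ ρ, mulDiag (fun _ => F ρ) (Pi.single ρ (1 : Rzl N)) := by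
    funext ρ
    simp [mulDiag, Finset.sum_apply, Pi.single_apply]
  conv_lhs => rw [h1, map_sum]
  rw [Finset.sum_apply]
  refine Finset.sum_congr rfl fun ρ _ => ?_
  rw [← Module.End.mul_apply, hx]
  rfl

theorem gaudin_entry_relation {x : Module.End ℂ (V1 N)}
    (hx : ∀ r : Rzl N, x * mulDiag (fun _ => r) = mulDiag (fun _ => r) * x)
    (k : Fin N) (hg : x * gaudin k = gaudin k * x) (τ ρ : Perm (Fin N)) :
    (∏ l ∈ Finset.univ.erase k, ((X (Sum.inr k) : Rzl N) - X (Sum.inr l))) *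
      (X (Sum.inl (ρ⁻¹ k)) - X (Sum.inl (τ⁻¹ k))) * x (Pi.single ρ 1) τ =
    ∑ j ∈ Finset.univ.erase k,
      (∏ l ∈ (Finset.univ.erase k).erase j, ((X (Sum.inr k) : Rzl N) - X (Sum.inr l))) *
      (x (Pi.single ρ 1) (swap k j * τ) - x (Pi.single (swap k j * ρ) 1) τ) := by
  have h := congrFun (LinearMap.congr_fun hg (Pi.single ρ 1)) τ
  simp only [Module.End.mul_apply] at h
  rw [gaudin_apply, apply_eq_sum_single hx] at h
  have h2 : ∀ (j : Fin N) (π : Perm (Fin N)),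
      (Pi.single ρ 1 : V1 N) (swap k j * π) = if π = swap k j * ρ then 1 else 0 := by
    intro j π
    have : swap k j * π = ρ ↔ π = swap k j * ρ := by
      rw [← inv_mul_eq_iff_eq_mul, swap_inv]
    simp only [Pi.single_apply, this]
  simp only [gaudin_apply, h2, add_mul, Finset.sum_mul, Finset.sum_add_distrib] at h
  rw [Finset.sum_comm] at h
  simp only [mul_ite, ite_mul, Pi.single_apply, mul_one, mul_zero, zero_mul, Finset.sum_ite_eq',
    Finset.mem_univ, if_true] at h
  simp only [mul_sub, Finset.sum_sub_distrib, sub_mul]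
  linear_combination h

/-- Polynomials all of whose monomials have degree less than `k`. -/
def degLT (N k : ℕ) : Submodule ℂ (Rzl N) := restrictSupport ℂ {m | m.degree < k}

theorem mem_degLT {k : ℕ} {p : Rzl N} : p ∈ degLT N k ↔ p = 0 ∨ p.totalDegree < k := by
  rw [degLT, mem_restrictSupport_iff]
  constructor
  · intro h
    by_cases hp : p = 0
    · exact Or.inl hp
    · right
      obtain ⟨m, hm, hm'⟩ := Finset.exists_mem_eq_sup p.support (support_nonempty.2 hp)
        (fun m => m.degree)
      have : p.totalDegree = m.degree := hm'
      rw [this]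
      exact h hm
  · rintro (rfl | h)
    · simp
    · intro m hm
      exact (le_totalDegree hm).trans_lt h

theorem mem_degLT_succ {k : ℕ} {p : Rzl N} : p ∈ degLT N (k + 1) ↔ p.totalDegree ≤ k := by
  rw [mem_degLT, Nat.lt_succ_iff]
  constructor
  · rintro (rfl | h)
    · simp
    · exact h
  · exact Or.inr

theorem degLT_mono {k l : ℕ} (h : k ≤ l) : degLT N k ≤ degLT N l :=
  restrictSupport_mono _ fun _ hm => lt_of_lt_of_le hm h

theorem mul_mem_degLT {k l : ℕ} {p q : Rzl N} (hp : p ∈ degLT N (k + 1)) (hq : q ∈ degLT N l) :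
    p * q ∈ degLT N (k + l) := by
  rw [mem_degLT_succ] at hp
  rw [mem_degLT] at hq ⊢
  rcases hq with rfl | hq
  · simp
  · right
    have := totalDegree_mul p q
    omega

theorem rename_mem_degLT {k : ℕ} {p : Rzl N} (hp : p ∈ degLT N k)
    (f : Fin N ⊕ Fin N → Fin N ⊕ Fin N) : rename f p ∈ degLT N k := by
  rw [mem_degLT] at hp ⊢
  rcases hp with rfl | hp
  · simp
  · exact Or.inr ((totalDegree_rename_le f p).trans_lt hp)

theorem X_sub_X_ne_zero {σ : Type*} {i j : σ} (h : i ≠ j) :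
    (X i - X j : MvPolynomial σ ℂ) ≠ 0 :=
  sub_ne_zero.2 fun h' => h (X_injective h')

theorem one_le_totalDegree_X_sub_X {σ : Type*} {i j : σ} (h : i ≠ j) :
    1 ≤ (X i - X j : MvPolynomial σ ℂ).totalDegree := by
  classical
  refine le_trans (by simp) (le_totalDegree (s := Finsupp.single i 1) ?_)
  rw [mem_support_iff, coeff_sub, coeff_X, coeff_X, if_pos rfl, if_neg]
  · simp
  · intro h'
    exact h (Finsupp.single_left_injective one_ne_zero h').symm

theorem off_diag_mem_degLT {x : Module.End ℂ (V1 N)}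
    (hx : ∀ r : Rzl N, x * mulDiag (fun _ => r) = mulDiag (fun _ => r) * x)
    (hg : ∀ k, x * gaudin k = gaudin k * x) {d : ℕ}
    (hd : ∀ τ ρ : Perm (Fin N), (x (Pi.single ρ 1) τ).totalDegree ≤ d)
    {τ ρ : Perm (Fin N)} (hne : τ ≠ ρ) : x (Pi.single ρ 1) τ ∈ degLT N d := by
  obtain ⟨k, hk⟩ : ∃ k, ρ⁻¹ k ≠ τ⁻¹ k := by
    by_contra! h
    exact hne (inv_injective (Equiv.ext fun k => (h k).symm))
  rw [mem_degLT]
  by_cases h0 : x (Pi.single ρ 1) τ = 0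
  · exact Or.inl h0
  right
  have hz : (Sum.inl (ρ⁻¹ k) : Fin N ⊕ Fin N) ≠ Sum.inl (τ⁻¹ k) :=
    fun h => hk (Sum.inl_injective h)
  have hfac : ∀ l ∈ Finset.univ.erase k, ((X (Sum.inr k) : Rzl N) - X (Sum.inr l)) ≠ 0 := by
    intro l hl
    refine X_sub_X_ne_zero fun h => ?_
    rw [Sum.inr.injEq] at h
    simp [h] at hl
  have hprod := Finset.prod_ne_zero_iff.2 hfac
  have h := congrArg totalDegree (gaudin_entry_relation hx k (hg k) τ ρ)
  rw [totalDegree_mul_of_isDomain (mul_ne_zero hprod (X_sub_X_ne_zero hz)) h0,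
    totalDegree_mul_of_isDomain hprod (X_sub_X_ne_zero hz)] at h
  have h1 := one_le_totalDegree_X_sub_X hz
  have h2 : (∑ j ∈ Finset.univ.erase k,
      (∏ l ∈ (Finset.univ.erase k).erase j, ((X (Sum.inr k) : Rzl N) - X (Sum.inr l))) *
      (x (Pi.single ρ 1) (swap k j * τ) - x (Pi.single (swap k j * ρ) 1) τ)).totalDegree ≤
      (∏ l ∈ Finset.univ.erase k, ((X (Sum.inr k) : Rzl N) - X (Sum.inr l))).totalDegree + d := by
    refine totalDegree_finsetSum_le fun j hj => (totalDegree_mul _ _).trans (add_le_add ?_ ?_)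
    · rw [← Finset.mul_prod_erase _ _ hj, totalDegree_mul_of_isDomain (hfac j hj)
        (Finset.prod_ne_zero_iff.2 fun l hl => hfac l (Finset.mem_of_mem_erase hl))]
      exact Nat.le_add_left _ _
    · exact (totalDegree_sub _ _).trans (max_le (hd _ _) (hd _ _))
  omega

/-- An operator commuting with multiplications and with the Gaudin Hamiltonians is determined
by its value on `Σ ε_σ`. -/
theorem eq_zero_of_apply_one_eq_zero {x : Module.End ℂ (V1 N)}
    (hx : ∀ r : Rzl N, x * mulDiag (fun _ => r) = mulDiag (fun _ => r) * x)
    (hg : ∀ k, x * gaudin k = gaudin k * x) (h1 : x (fun _ => 1) = 0) : x = 0 := by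
  obtain ⟨⟨τ, ρ⟩, hmax⟩ := Finite.exists_max
    (fun q : Perm (Fin N) × Perm (Fin N) => (x (Pi.single q.2 1) q.1).totalDegree)
  set d := (x (Pi.single ρ 1) τ).totalDegree with hd
  have hoff : ∀ {τ ρ : Perm (Fin N)}, τ ≠ ρ → x (Pi.single ρ 1) τ ∈ degLT N d :=
    off_diag_mem_degLT hx hg (fun τ ρ => hmax (τ, ρ))
  have hdiag : ∀ τ : Perm (Fin N), x (Pi.single τ 1) τ ∈ degLT N d := by
    intro τ
    have := apply_eq_sum_single hx (fun _ => 1) τ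
    rw [h1, ← Finset.add_sum_erase _ _ (Finset.mem_univ τ)] at this
    simp only [one_mul, Pi.zero_apply] at this
    rw [eq_neg_of_add_eq_zero_left this.symm]
    exact neg_mem (sum_mem fun ρ hρ => hoff (Finset.ne_of_mem_erase hρ).symm)
  have hall : ∀ τ ρ : Perm (Fin N), x (Pi.single ρ 1) τ ∈ degLT N d := by
    intro τ ρ
    by_cases h : τ = ρ
    · exact h ▸ hdiag τ
    · exact hoff h
  have hd0 : d = 0 := by
    rcases mem_degLT.1 (hall τ ρ) with h | h
    · rw [hd, h, totalDegree_zero]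
    · exact absurd h (lt_irrefl _)
  refine LinearMap.ext fun F => funext fun π => ?_
  rw [apply_eq_sum_single hx]
  refine Finset.sum_eq_zero fun ρ' _ => ?_
  have := hall π ρ'
  rw [hd0, mem_degLT] at this
  simp [this.resolve_right (Nat.not_lt_zero _)]

/-- The reversed characteristic polynomial `∏ (1 - x_m t)` over the complement of `T`. -/
def revProd {R : Type*} [CommRing R] (x : Fin N → R) (T : Finset (Fin N)) : Polynomial R :=
  ∏ m ∈ Tᶜ, (1 - Polynomial.C (x m) * Polynomial.X)

/-- Alternating sum of a vector over the permutations supported in `T`. -/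
def altSum (T : Finset (Fin N)) (F : V1 N) (τ : Perm (Fin N)) : Rzl N :=
  ∑ σ : Perm (Fin N), if ∀ m ∈ Tᶜ, σ m = m then ((Perm.sign σ : ℤ) : Rzl N) * F (σ⁻¹ * τ) else 0

theorem natDegree_revProd_le {R : Type*} [CommRing R] (x : Fin N → R) (T : Finset (Fin N)) :
    (revProd x T).natDegree ≤ Tᶜ.card := by
  have h := Polynomial.natDegree_prod_le Tᶜ
    (fun m => (1 - Polynomial.C (x m) * Polynomial.X : Polynomial R))
  refine h.trans ((Finset.sum_le_card_nsmul _ _ 1 fun m _ => ?_).trans (by simp))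
  refine (Polynomial.natDegree_sub_le _ _).trans (max_le (by simp) ?_)
  simpa using Polynomial.natDegree_C_mul_X_pow_le (x m) 1

theorem fixProd_eq_sum {R : Type*} [CommRing R] (u v : R) (x y : Fin N → R)
    (σ : Perm (Fin N)) :
    (-1) ^ N * fixProd u v x y σ = ∑ T : Finset (Fin N), if ∀ m ∈ Tᶜ, σ m = m then
      (-1) ^ T.card * ((∏ m ∈ Tᶜ, (u - x m)) * ∏ m ∈ Tᶜ, (v - y m)) else 0 := by
  have h : fixProd u v x y σ =
      ∏ i, (1 + if σ i = i then -((u - x i) * (v - y i)) else 0) := by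
    refine Finset.prod_congr rfl fun i _ => ?_
    split_ifs <;> ring
  rw [h, Finset.prod_one_add, Finset.powerset_univ, Finset.mul_sum,
    ← Equiv.sum_comp (compl_involutive (α := Finset (Fin N))).toPerm]
  refine Finset.sum_congr rfl fun T _ => ?_
  simp only [Function.Involutive.coe_toPerm]
  rw [Finset.prod_ite_zero]
  split_ifs
  · rw [Finset.prod_neg, Finset.prod_mul_distrib, ← mul_assoc]
    congr 1
    have hc : T.card + Tᶜ.card = N := by simp
    have hp : (-1 : R) ^ N = (-1) ^ T.card * (-1) ^ Tᶜ.card := by rw [← pow_add, hc]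
    calc (-1 : R) ^ N * (-1) ^ Tᶜ.card = (-1) ^ T.card * ((-1) ^ Tᶜ.card * (-1) ^ Tᶜ.card) := by
          rw [hp, mul_assoc]
      _ = (-1) ^ T.card := by rw [← mul_pow]; simp
  · simp

theorem PB_apply_eq_sum_altSum (u v : ℂ) (F : V1 N) (τ : Perm (Fin N)) :
    PB N u v F τ = ∑ T : Finset (Fin N), (-1) ^ T.card *
      ((∏ m ∈ Tᶜ, (C u - X (Sum.inl (τ⁻¹ m)))) * ∏ m ∈ Tᶜ, (C v - X (Sum.inr m))) *
      altSum T F τ := by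
  rw [PB_apply, Finset.mul_sum]
  have h : ∀ σ : Perm (Fin N), (-1 : Rzl N) ^ N * (((Perm.sign σ : ℤ) : Rzl N) *
      (fixProd (C u) (C v) (fun i => X (Sum.inl (τ⁻¹ i))) (fun i => X (Sum.inr i)) σ *
        F (σ⁻¹ * τ))) =
      ∑ T : Finset (Fin N), (-1) ^ T.card *
      ((∏ m ∈ Tᶜ, (C u - X (Sum.inl (τ⁻¹ m)))) * ∏ m ∈ Tᶜ, (C v - X (Sum.inr m))) *
      (if ∀ m ∈ Tᶜ, σ m = m then ((Perm.sign σ : ℤ) : Rzl N) * F (σ⁻¹ * τ) else 0) := by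
    intro σ
    rw [mul_left_comm, ← mul_assoc (_ ^ N), fixProd_eq_sum, Finset.sum_mul, Finset.mul_sum]
    refine Finset.sum_congr rfl fun T _ => ?_
    split_ifs
    · ring
    · simp
  rw [Finset.sum_congr rfl fun σ _ => h σ, Finset.sum_comm]
  simp only [altSum, Finset.mul_sum]

theorem sum_pow_mul_coeff_revProd {u : ℂ} (hu : u ≠ 0) (x : Fin N → Rzl N)
    (T : Finset (Fin N)) :
    ∑ i : Fin (N + 1), u ^ (N - (i : ℕ)) • (Polynomial.X ^ T.card * revProd x T).coeff i =
      ∏ m ∈ Tᶜ, (C u - x m) := by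
  have hc : T.card + Tᶜ.card = N := by simp
  have hdeg : (Polynomial.X ^ T.card * revProd x T).natDegree < N + 1 := by
    have h1 := Polynomial.natDegree_mul_le (p := Polynomial.X ^ T.card) (q := revProd x T)
    have h2 := natDegree_revProd_le x T
    have h3 := Polynomial.natDegree_X_pow_le (R := Rzl N) T.card
    omega
  have hCu : (C u : Rzl N) * C u⁻¹ = 1 := by rw [← C_mul, mul_inv_cancel₀ hu, C_1]
  have h1 : ∑ i : Fin (N + 1), u ^ (N - (i : ℕ)) •
      (Polynomial.X ^ T.card * revProd x T).coeff i =
      C u ^ N * (Polynomial.X ^ T.card * revProd x T).eval (C u⁻¹) := by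
    rw [Polynomial.eval_eq_sum_range' hdeg, Finset.sum_range, Finset.mul_sum]
    refine Finset.sum_congr rfl fun i _ => ?_
    have hi : (C u : Rzl N) ^ N = C u ^ (N - (i : ℕ)) * C u ^ (i : ℕ) := by
      rw [← pow_add, Nat.sub_add_cancel (Nat.lt_succ_iff.1 i.2)]
    have h2 : (C u : Rzl N) ^ N * C u⁻¹ ^ (i : ℕ) = C (u ^ (N - (i : ℕ))) := by
      rw [hi, mul_assoc, ← mul_pow, hCu, one_pow, mul_one, C_pow]
    rw [smul_eq_C_mul, ← h2]
    ring
  have hN : (C u : Rzl N) ^ N = C u ^ T.card * C u ^ Tᶜ.card := by rw [← pow_add, hc]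
  rw [h1, hN, Polynomial.eval_mul, Polynomial.eval_pow, Polynomial.eval_X, revProd,
    Polynomial.eval_prod, mul_mul_mul_comm, ← mul_pow, hCu, one_pow, one_mul, ← Finset.prod_const,
    ← Finset.prod_mul_distrib]
  refine Finset.prod_congr rfl fun m _ => ?_
  simp only [Polynomial.eval_sub, Polynomial.eval_one, Polynomial.eval_mul, Polynomial.eval_C,
    Polynomial.eval_X]
  linear_combination (-x m) * hCu

theorem mul_sum_smul_mul_sum_smul_mul {ι κ A : Type*} [Fintype ι] [Fintype κ] [CommRing A]
    [Algebra ℂ A] (α : ι → ℂ) (β : κ → ℂ) (c : A) (a : ι → A) (b : κ → A) (d : A) :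
    c * ((∑ i, α i • a i) * ∑ j, β j • b j) * d =
      ∑ i, ∑ j, (α i * β j) • (c * (a i * b j) * d) := by
  rw [Finset.sum_mul_sum, Finset.mul_sum, Finset.sum_mul]
  refine Finset.sum_congr rfl fun i _ => ?_
  rw [Finset.mul_sum, Finset.sum_mul]
  refine Finset.sum_congr rfl fun j _ => ?_
  rw [smul_mul_smul_comm, mul_smul_comm, smul_mul_assoc]

theorem eq_of_sum_sum_pow_sub_smul_eq {M : Type*} [AddCommGroup M] [Module ℂ M]
    {x y : Fin (N + 1) → Fin (N + 1) → M}
    (h : ∀ u v : ℂ, u ≠ 0 → v ≠ 0 →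
      ∑ i : Fin (N + 1), ∑ j : Fin (N + 1), (u ^ (N - (i : ℕ)) * v ^ (N - (j : ℕ))) • x i j =
      ∑ i : Fin (N + 1), ∑ j : Fin (N + 1), (u ^ (N - (i : ℕ)) * v ^ (N - (j : ℕ))) • y i j) :
    x = y := by
  funext i j
  refine sub_eq_zero.1 (sum_sum_pow_sub_smul_eq_zero (fun i j => x i j - y i j)
    (fun u v hu hv => ?_) i j)
  simp only [smul_sub, Finset.sum_sub_distrib]
  exact sub_eq_zero.2 (h u v hu hv)

/-- The coefficient of `u ^ (N - i) * v ^ (N - j)` in `PB N u v F τ`. -/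
def betheCoeff (i j : ℕ) (F : V1 N) (τ : Perm (Fin N)) : Rzl N :=
  ∑ T : Finset (Fin N), (-1) ^ T.card *
    ((Polynomial.X ^ T.card * revProd (fun m => (X (Sum.inl (τ⁻¹ m)) : Rzl N)) T).coeff i *
    (Polynomial.X ^ T.card * revProd (fun m => (X (Sum.inr m) : Rzl N)) T).coeff j) *
    altSum T F τ

theorem sum_sum_smul_betheCoeff {u v : ℂ} (hu : u ≠ 0) (hv : v ≠ 0) (F : V1 N)
    (τ : Perm (Fin N)) :
    ∑ i : Fin (N + 1), ∑ j : Fin (N + 1),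
      (u ^ (N - (i : ℕ)) * v ^ (N - (j : ℕ))) • betheCoeff i j F τ = PB N u v F τ := by
  rw [PB_apply_eq_sum_altSum]
  simp only [← sum_pow_mul_coeff_revProd hu, ← sum_pow_mul_coeff_revProd hv,
    mul_sum_smul_mul_sum_smul_mul, betheCoeff, Finset.smul_sum]
  symm
  rw [Finset.sum_comm]
  exact Finset.sum_congr rfl fun i _ => Finset.sum_comm

theorem eq_betheCoeff {bb : Fin (N + 1) → Fin (N + 1) → Module.End ℂ (V1 N)}
    (hb : ∀ u v : ℂ, PB N u v =
      ∑ i : Fin (N + 1), ∑ j : Fin (N + 1),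
        (u ^ (N - (i : ℕ)) * v ^ (N - (j : ℕ))) • bb i j)
    (i j : Fin (N + 1)) (F : V1 N) (τ : Perm (Fin N)) :
    bb i j F τ = betheCoeff i j F τ := by
  suffices key : (fun i j => bb i j F τ) = fun (i j : Fin (N + 1)) => betheCoeff i j F τ from
    congrFun (congrFun key i) j
  refine eq_of_sum_sum_pow_sub_smul_eq fun u v hu hv => ?_
  have h := congrFun (LinearMap.congr_fun (hb u v) F) τ
  simp only [LinearMap.sum_apply, Finset.sum_apply, LinearMap.smul_apply, Pi.smul_apply] at h
  rw [← h, sum_sum_smul_betheCoeff hu hv]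

/-- `b` agrees, up to terms of lower degree, with multiplication by `f` of degree at most `d`,
where `f` acts on `ε_τ` with its first group of variables permuted by `τ⁻¹`. -/
def HasSymbol (b : Module.End ℂ (V1 N)) (d : ℕ) (f : Rzl N) : Prop :=
  f ∈ degLT N (d + 1) ∧ ∀ (k : ℕ) (F : V1 N), (∀ τ, F τ ∈ degLT N (k + 1)) → ∀ τ : Perm (Fin N),
    b F τ - rename (Sum.map (τ⁻¹ : Perm (Fin N)) id) f * F τ ∈ degLT N (k + d)

theorem HasSymbol.apply_mem {b : Module.End ℂ (V1 N)} {d : ℕ} {f : Rzl N} (h : HasSymbol b d f)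
    {k : ℕ} {F : V1 N} (hF : ∀ τ, F τ ∈ degLT N k) (τ : Perm (Fin N)) :
    b F τ ∈ degLT N (k + d) := by
  cases k with
  | zero =>
    have : F = 0 := funext fun τ => (mem_degLT.1 (hF τ)).resolve_right (Nat.not_lt_zero _)
    simp [this]
  | succ k =>
    have h1 := h.2 k F hF τ
    have h2 := mul_mem_degLT (rename_mem_degLT h.1 (Sum.map (τ⁻¹ : Perm (Fin N)) id)) (hF τ)
    have := add_mem (degLT_mono (show k + d ≤ k + 1 + d by omega) h1)
      (degLT_mono (show d + (k + 1) ≤ k + 1 + d by omega) h2)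
    rwa [sub_add_cancel] at this

theorem HasSymbol.mul {b b' : Module.End ℂ (V1 N)} {d d' : ℕ} {f f' : Rzl N}
    (h : HasSymbol b d f) (h' : HasSymbol b' d' f') : HasSymbol (b * b') (d + d') (f * f') := by
  refine ⟨degLT_mono (by omega) (mul_mem_degLT h.1 h'.1), fun k F hF τ => ?_⟩
  set G : V1 N := fun τ => rename (Sum.map (τ⁻¹ : Perm (Fin N)) id) f' * F τ with hG
  have h1 : ∀ τ, (b' F - G) τ ∈ degLT N (k + d') := h'.2 k F hF
  have h2 : ∀ τ, G τ ∈ degLT N (d' + k + 1) := fun τ =>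
    mul_mem_degLT (k := d') (l := k + 1) (rename_mem_degLT h'.1 _) (hF τ)
  have h3 := add_mem (degLT_mono (show k + d' + d ≤ k + (d + d') by omega) (h.apply_mem h1 τ))
    (degLT_mono (show d' + k + d ≤ k + (d + d') by omega) (h.2 (d' + k) G h2 τ))
  convert h3 using 1
  rw [Module.End.mul_apply, map_sub, map_mul, hG]
  simp only [Pi.sub_apply]
  ring

/-- Symbols of order `d` of the elements of an algebra of operators. -/
def symbols (B : Subalgebra ℂ (Module.End ℂ (V1 N))) (d : ℕ) : Submodule ℂ (Rzl N) where
  carrier := {f | ∃ b ∈ B, HasSymbol b d f}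
  zero_mem' := ⟨0, zero_mem _, zero_mem _, fun k F hF τ => by simp⟩
  add_mem' := by
    rintro f g ⟨b, hb, hf⟩ ⟨c, hc, hg⟩
    refine ⟨b + c, add_mem hb hc, add_mem hf.1 hg.1, fun k F hF τ => ?_⟩
    convert add_mem (hf.2 k F hF τ) (hg.2 k F hF τ) using 1
    rw [map_add, LinearMap.add_apply, Pi.add_apply]
    ring
  smul_mem' := by
    rintro c f ⟨b, hb, hf⟩
    refine ⟨c • b, Subalgebra.smul_mem _ hb c, Submodule.smul_mem _ c hf.1, fun k F hF τ => ?_⟩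
    convert Submodule.smul_mem _ c (hf.2 k F hF τ) using 1
    rw [map_smul, LinearMap.smul_apply, Pi.smul_apply, smul_mul_assoc, smul_sub]

variable {B : Subalgebra ℂ (Module.End ℂ (V1 N))}

theorem symbols_mono {d e : ℕ} (h : d ≤ e) : symbols B d ≤ symbols B e := by
  rintro f ⟨b, hb, hf⟩
  exact ⟨b, hb, degLT_mono (by omega) hf.1, fun k F hF τ => degLT_mono (by omega) (hf.2 k F hF τ)⟩

theorem mul_mem_symbols {d e : ℕ} {f g : Rzl N} (hf : f ∈ symbols B d) (hg : g ∈ symbols B e) :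
    f * g ∈ symbols B (d + e) := by
  obtain ⟨b, hb, hf⟩ := hf
  obtain ⟨c, hc, hg⟩ := hg
  exact ⟨b * c, mul_mem hb hc, hf.mul hg⟩

theorem one_mem_symbols : (1 : Rzl N) ∈ symbols B 0 :=
  ⟨1, one_mem _, by rw [mem_degLT_succ, totalDegree_one], fun k F hF τ => by simp⟩

theorem coeff_revProd_mem_degLT {x : Fin N → Rzl N} (hx : ∀ m, x m ∈ degLT N 2)
    (T : Finset (Fin N)) (n : ℕ) : (revProd x T).coeff n ∈ degLT N (n + 1) := by
  unfold revProd
  induction Tᶜ using Finset.induction_on generalizing n with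
  | empty =>
    rw [Finset.prod_empty, Polynomial.coeff_one]
    split_ifs
    · rw [mem_degLT_succ, totalDegree_one]
      exact Nat.zero_le _
    · exact zero_mem _
  | insert m S hm ih =>
    rw [Finset.prod_insert hm, sub_mul, one_mul, mul_assoc, Polynomial.coeff_sub,
      Polynomial.coeff_C_mul]
    refine sub_mem (ih n) ?_
    cases n with
    | zero => simp
    | succ n =>
      rw [Polynomial.coeff_X_mul]
      exact degLT_mono (by omega) (mul_mem_degLT (hx m) (ih n))

theorem coeff_X_pow_mul_revProd_mem_degLT {x : Fin N → Rzl N} (hx : ∀ m, x m ∈ degLT N 2)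
    (T : Finset (Fin N)) {t : ℕ} (ht : 2 ≤ t) (n : ℕ) :
    (Polynomial.X ^ t * revProd x T).coeff (n + 1) ∈ degLT N n := by
  rw [Polynomial.coeff_X_pow_mul']
  split_ifs with h
  · exact degLT_mono (by omega) (coeff_revProd_mem_degLT hx T _)
  · exact zero_mem _

theorem X_mem_degLT_two (i : Fin N ⊕ Fin N) : (X i : Rzl N) ∈ degLT N 2 := by
  rw [mem_degLT_succ, totalDegree_X]

theorem altSum_mem_degLT {k : ℕ} {F : V1 N} (hF : ∀ τ, F τ ∈ degLT N k) (T : Finset (Fin N))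
    (τ : Perm (Fin N)) : altSum T F τ ∈ degLT N k := by
  refine sum_mem fun σ _ => ?_
  split_ifs
  · rw [← zsmul_eq_mul]
    exact zsmul_mem (hF _) _
  · exact zero_mem _

theorem altSum_of_card_le_one {T : Finset (Fin N)} (hT : T.card ≤ 1) (F : V1 N)
    (τ : Perm (Fin N)) : altSum T F τ = F τ := by
  rw [altSum, Finset.sum_eq_single 1]
  · simp
  · intro σ _ hσ
    refine if_neg fun h => hσ ?_
    have hsupp : σ.support ⊆ T := by
      intro m hm
      by_contra hmT
      exact Perm.mem_support.1 hm (h m (Finset.mem_compl.2 hmT))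
    exact Perm.card_support_le_one.1 ((Finset.card_le_card hsupp).trans hT)
  · simp

theorem sum_finset_eq_empty_add_singleton_add {M : Type*} [AddCommMonoid M]
    (g : Finset (Fin N) → M) :
    ∑ T, g T = g ∅ + ∑ k, g {k} + ∑ T ∈ Finset.univ.filter (fun T => 2 ≤ T.card), g T := by
  rw [← Finset.sum_filter_not_add_sum_filter Finset.univ (fun T : Finset (Fin N) => 2 ≤ T.card)]
  congr 1
  have : Finset.univ.filter (fun T : Finset (Fin N) => ¬ 2 ≤ T.card) =
      insert ∅ (Finset.univ.image fun k => {k}) := by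
    ext T
    simp only [Finset.mem_filter, Finset.mem_univ, true_and, not_le, Finset.mem_insert,
      Finset.mem_image, Nat.lt_succ_iff, Nat.le_one_iff_eq_zero_or_eq_one, Finset.card_eq_zero,
      Finset.card_eq_one, eq_comm (a := T)]
  rw [this, Finset.sum_insert (by simp),
    Finset.sum_image fun a _ b _ h => Finset.singleton_injective h]

theorem rename_coeff_revProd (τ : Perm (Fin N)) (T : Finset (Fin N)) (n : ℕ) :
    rename (Sum.map τ id) ((revProd (fun m => (X (Sum.inl m) : Rzl N)) T).coeff n) =
      (revProd (fun m => (X (Sum.inl (τ m)) : Rzl N)) T).coeff n := by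
  have h : (revProd (fun m => (X (Sum.inl m) : Rzl N)) T).map
      (rename (R := ℂ) (Sum.map τ id) : Rzl N →ₐ[ℂ] Rzl N).toRingHom =
      revProd (fun m => (X (Sum.inl (τ m)) : Rzl N)) T := by
    simp [revProd, Polynomial.map_prod]
  rw [← h, Polynomial.coeff_map]
  rfl

theorem rename_coeff_revProd_inr (τ : Perm (Fin N)) (T : Finset (Fin N)) (n : ℕ) :
    rename (Sum.map τ id) ((revProd (fun m => (X (Sum.inr m) : Rzl N)) T).coeff n) =
      (revProd (fun m => (X (Sum.inr m) : Rzl N)) T).coeff n := by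
  have h : (revProd (fun m => (X (Sum.inr m) : Rzl N)) T).map
      (rename (R := ℂ) (Sum.map τ id) : Rzl N →ₐ[ℂ] Rzl N).toRingHom =
      revProd (fun m => (X (Sum.inr m) : Rzl N)) T := by
    simp [revProd, Polynomial.map_prod]
  conv_rhs => rw [← h, Polynomial.coeff_map]
  rfl

/-- Up to sign, the elementary symmetric polynomials in the `z_m` with `m ∉ T`. -/
def esymZ (T : Finset (Fin N)) (n : ℕ) : Rzl N :=
  (revProd (fun m => (X (Sum.inl m) : Rzl N)) T).coeff n

/-- Up to sign, the elementary symmetric polynomials in the `λ_m` with `m ∉ T`. -/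
def esymL (T : Finset (Fin N)) (n : ℕ) : Rzl N :=
  (revProd (fun m => (X (Sum.inr m) : Rzl N)) T).coeff n

theorem esymZ_mem_degLT (T : Finset (Fin N)) (n : ℕ) : esymZ T n ∈ degLT N (n + 1) :=
  coeff_revProd_mem_degLT (fun m => X_mem_degLT_two (Sum.inl m)) T n

theorem esymL_mem_degLT (T : Finset (Fin N)) (n : ℕ) : esymL T n ∈ degLT N (n + 1) :=
  coeff_revProd_mem_degLT (fun m => X_mem_degLT_two (Sum.inr m)) T n

theorem coeff_revProd_eq_zero {R : Type*} [CommRing R] (x : Fin N → R) {T : Finset (Fin N)}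
    {n : ℕ} (h : N < n + T.card) : (revProd x T).coeff n = 0 := by
  refine Polynomial.coeff_eq_zero_of_natDegree_lt ((natDegree_revProd_le x T).trans_lt ?_)
  have hc : T.card + Tᶜ.card = N := by simp
  omega

theorem coeff_revProd_singleton_zero {R : Type*} [CommRing R] (x : Fin N → R) (k : Fin N) :
    (revProd x {k}).coeff 0 = 1 := by
  rw [Polynomial.coeff_zero_eq_eval_zero, revProd, Polynomial.eval_prod]
  simp

theorem mul_coeff_revProd_singleton {R : Type*} [CommRing R] (x : Fin N → R) (k : Fin N)
    (n : ℕ) : x k * (revProd x {k}).coeff n =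
      (revProd x {k}).coeff (n + 1) - (revProd x ∅).coeff (n + 1) := by
  have h : revProd x ∅ = (1 - Polynomial.C (x k) * Polynomial.X) * revProd x {k} := by
    rw [revProd, revProd, Finset.compl_empty, Finset.compl_singleton]
    exact (Finset.mul_prod_erase _ _ (Finset.mem_univ k)).symm
  rw [h, sub_mul, one_mul, mul_assoc, Polynomial.coeff_sub, Polynomial.coeff_C_mul,
    Polynomial.coeff_X_mul]
  ring

theorem betheCoeff_zero_right (i : ℕ) (F : V1 N) (τ : Perm (Fin N)) :
    betheCoeff i 0 F τ = rename (Sum.map (τ⁻¹ : Perm (Fin N)) id) (esymZ ∅ i) * F τ := by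
  have h0 : (revProd (fun m => (X (Sum.inr m) : Rzl N)) ∅).coeff 0 = 1 := by
    rw [Polynomial.coeff_zero_eq_eval_zero, revProd, Polynomial.eval_prod]
    simp
  rw [betheCoeff, Finset.sum_eq_single ∅]
  · rw [altSum_of_card_le_one (by simp), esymZ, rename_coeff_revProd]
    simp [h0]
  · intro T _ hT
    rw [Polynomial.coeff_X_pow_mul' _ _ 0, if_neg]
    · simp
    · simpa using hT
  · simp

theorem betheCoeff_zero_left (j : ℕ) (F : V1 N) (τ : Perm (Fin N)) :
    betheCoeff 0 j F τ = rename (Sum.map (τ⁻¹ : Perm (Fin N)) id) (esymL ∅ j) * F τ := by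
  have h0 : (revProd (fun m => (X (Sum.inl (τ⁻¹ m)) : Rzl N)) ∅).coeff 0 = 1 := by
    rw [Polynomial.coeff_zero_eq_eval_zero, revProd, Polynomial.eval_prod]
    simp
  rw [betheCoeff, Finset.sum_eq_single ∅]
  · rw [altSum_of_card_le_one (by simp), esymL, rename_coeff_revProd_inr]
    rw [Finset.card_empty, pow_zero, pow_zero, one_mul, one_mul, one_mul, h0, one_mul]
  · intro T _ hT
    rw [Polynomial.coeff_X_pow_mul' _ _ 0, if_neg]
    · simp
    · simpa using hT
  · simp

/-- The contribution to `betheCoeff` of the sets with at least two elements. -/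
def betheRest (a b : ℕ) (F : V1 N) (τ : Perm (Fin N)) : Rzl N :=
  ∑ T ∈ Finset.univ.filter (fun T : Finset (Fin N) => 2 ≤ T.card), (-1) ^ T.card *
    ((Polynomial.X ^ T.card * revProd (fun m => (X (Sum.inl (τ⁻¹ m)) : Rzl N)) T).coeff (a + 1) *
    (Polynomial.X ^ T.card * revProd (fun m => (X (Sum.inr m) : Rzl N)) T).coeff (b + 1)) *
    altSum T F τ

theorem betheRest_mem_degLT {k : ℕ} {F : V1 N} (hF : ∀ τ, F τ ∈ degLT N (k + 1)) (a b : ℕ)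
    (τ : Perm (Fin N)) : betheRest a b F τ ∈ degLT N (k + (a + b)) := by
  refine sum_mem fun T hT => ?_
  have hT2 : 2 ≤ T.card := (Finset.mem_filter.1 hT).2
  have h1 := mul_mem_degLT (degLT_mono (Nat.le_succ a) (coeff_X_pow_mul_revProd_mem_degLT
    (fun m => X_mem_degLT_two (Sum.inl (τ⁻¹ m))) T hT2 a))
    (coeff_X_pow_mul_revProd_mem_degLT (fun m => X_mem_degLT_two (Sum.inr m)) T hT2 b)
  have h2 := mul_mem_degLT (altSum_mem_degLT hF T τ) h1
  rcases neg_one_pow_eq_or (Rzl N) T.card with hs | hs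
  · rw [hs, one_mul, mul_comm]
    exact h2
  · rw [hs, neg_one_mul, neg_mul, mul_comm]
    exact neg_mem h2

theorem betheCoeff_succ_succ (a b : ℕ) (F : V1 N) (τ : Perm (Fin N)) :
    betheCoeff (a + 1) (b + 1) F τ =
      rename (Sum.map (τ⁻¹ : Perm (Fin N)) id) (esymZ ∅ (a + 1) * esymL ∅ (b + 1)) * F τ -
      rename (Sum.map (τ⁻¹ : Perm (Fin N)) id) (∑ k, esymZ {k} a * esymL {k} b) * F τ +
      betheRest a b F τ := by
  rw [betheCoeff, sum_finset_eq_empty_add_singleton_add, betheRest]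
  congr 1
  rw [sub_eq_add_neg, map_sum, Finset.sum_mul, ← Finset.sum_neg_distrib]
  congr 1
  · rw [altSum_of_card_le_one (by simp), map_mul, esymZ, esymL, rename_coeff_revProd,
      rename_coeff_revProd_inr]
    simp
  · refine Finset.sum_congr rfl fun k _ => ?_
    rw [altSum_of_card_le_one (by simp), map_mul, esymZ, esymL, rename_coeff_revProd,
      rename_coeff_revProd_inr]
    simp

theorem esymZ_mem_symbols {bb : Fin (N + 1) → Fin (N + 1) → Module.End ℂ (V1 N)}
    (hbb : ∀ i j F τ, bb i j F τ = betheCoeff i j F τ) (hB : ∀ i j, bb i j ∈ B) (n : ℕ) :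
    esymZ ∅ n ∈ symbols B n := by
  by_cases hn : n < N + 1
  · refine ⟨bb ⟨n, hn⟩ 0, hB _ _, esymZ_mem_degLT _ _, fun k F _ τ => ?_⟩
    rw [hbb, Fin.val_zero, betheCoeff_zero_right, sub_self]
    exact zero_mem _
  · rw [esymZ, coeff_revProd_eq_zero _ (by simp; omega)]
    exact zero_mem _

theorem esymL_mem_symbols {bb : Fin (N + 1) → Fin (N + 1) → Module.End ℂ (V1 N)}
    (hbb : ∀ i j F τ, bb i j F τ = betheCoeff i j F τ) (hB : ∀ i j, bb i j ∈ B) (n : ℕ) :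
    esymL ∅ n ∈ symbols B n := by
  by_cases hn : n < N + 1
  · refine ⟨bb 0 ⟨n, hn⟩, hB _ _, esymL_mem_degLT _ _, fun k F _ τ => ?_⟩
    rw [hbb, Fin.val_zero, betheCoeff_zero_left, sub_self]
    exact zero_mem _
  · rw [esymL, coeff_revProd_eq_zero _ (by simp; omega)]
    exact zero_mem _

theorem bethe_mul_sub_apply {bb : Fin (N + 1) → Fin (N + 1) → Module.End ℂ (V1 N)}
    (hbb : ∀ i j F τ, bb i j F τ = betheCoeff i j F τ) {a b : ℕ} (ha : a + 1 < N + 1)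
    (hb : b + 1 < N + 1) (F : V1 N) (τ : Perm (Fin N)) :
    (bb ⟨a + 1, ha⟩ 0 * bb 0 ⟨b + 1, hb⟩ - bb ⟨a + 1, ha⟩ ⟨b + 1, hb⟩) F τ =
      rename (Sum.map (τ⁻¹ : Perm (Fin N)) id) (∑ k, esymZ {k} a * esymL {k} b) * F τ -
        betheRest a b F τ := by
  have h1 : bb ⟨a + 1, ha⟩ 0 (bb 0 ⟨b + 1, hb⟩ F) τ = rename (Sum.map (τ⁻¹ : Perm (Fin N)) id)
      (esymZ ∅ (a + 1) * esymL ∅ (b + 1)) * F τ := by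
    rw [hbb, Fin.val_zero, betheCoeff_zero_right, hbb, Fin.val_zero, betheCoeff_zero_left, map_mul,
      mul_assoc]
  have h2 := hbb ⟨a + 1, ha⟩ ⟨b + 1, hb⟩ F τ
  rw [betheCoeff_succ_succ] at h2
  rw [LinearMap.sub_apply, Pi.sub_apply, Module.End.mul_apply, h1, h2]
  generalize rename (Sum.map (τ⁻¹ : Perm (Fin N)) id) (esymZ ∅ (a + 1) * esymL ∅ (b + 1)) * F τ = p
  abel

theorem sum_esymZ_mul_esymL_mem_symbols
    {bb : Fin (N + 1) → Fin (N + 1) → Module.End ℂ (V1 N)}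
    (hbb : ∀ i j F τ, bb i j F τ = betheCoeff i j F τ) (hB : ∀ i j, bb i j ∈ B) (a b : ℕ) :
    ∑ k, esymZ {k} a * esymL {k} b ∈ symbols B (a + b) := by
  by_cases ha : a < N
  swap
  · refine sum_mem fun k _ => ?_
    rw [esymZ, coeff_revProd_eq_zero _ (by simp; omega), zero_mul]
    exact zero_mem _
  by_cases hb : b < N
  swap
  · refine sum_mem fun k _ => ?_
    rw [esymL, coeff_revProd_eq_zero _ (by simp; omega), mul_zero]
    exact zero_mem _
  have hmem : bb ⟨a + 1, by omega⟩ 0 * bb 0 ⟨b + 1, by omega⟩ -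
      bb ⟨a + 1, by omega⟩ ⟨b + 1, by omega⟩ ∈ B :=
    sub_mem (mul_mem (hB ⟨a + 1, by omega⟩ 0) (hB 0 ⟨b + 1, by omega⟩)) (hB _ _)
  have hdeg : ∑ k, esymZ {k} a * esymL {k} b ∈ degLT N (a + b + 1) :=
    sum_mem fun k _ => mul_mem_degLT (k := a) (l := b + 1)
      (esymZ_mem_degLT {k} a) (esymL_mem_degLT {k} b)
  refine ⟨_, hmem, hdeg, fun k F hF τ => ?_⟩
  rw [bethe_mul_sub_apply hbb (by omega) (by omega), sub_sub_cancel_left]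
  exact neg_mem (betheRest_mem_degLT hF a b τ)

theorem sum_mul_mem_symbols (hz : ∀ n, esymZ ∅ n ∈ symbols B n)
    (hl : ∀ n, esymL ∅ n ∈ symbols B n)
    (hq : ∀ a b, ∑ k, esymZ {k} a * esymL {k} b ∈ symbols B (a + b)) (r s a b : ℕ) :
    ∑ k, X (Sum.inl k) ^ r * esymZ {k} a * (X (Sum.inr k) ^ s * esymL {k} b) ∈
      symbols B (r + a + (s + b)) := by
  induction r generalizing a with
  | zero =>
    induction s generalizing b with
    | zero => simpa using hq a b
    | succ s ih =>
      have h : ∀ k : Fin N, X (Sum.inr k) ^ (s + 1) * esymL {k} b =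
          X (Sum.inr k) ^ s * esymL {k} (b + 1) -
            esymL ∅ (b + 1) * (X (Sum.inr k) ^ s * esymL {k} 0) := by
        intro k
        have h0 : esymL {k} 0 = 1 := coeff_revProd_singleton_zero _ k
        have h1 : X (Sum.inr k) * esymL {k} b = esymL {k} (b + 1) - esymL ∅ (b + 1) :=
          mul_coeff_revProd_singleton _ k b
        rw [h0, pow_succ, mul_assoc, h1]
        ring
      simp only [h, mul_sub, Finset.sum_sub_distrib, mul_left_comm _ (esymL ∅ (b + 1)),
        ← Finset.mul_sum]
      refine sub_mem (symbols_mono (by omega) (ih (b + 1)))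
        (symbols_mono (by omega) (mul_mem_symbols (hl (b + 1)) (ih 0)))
  | succ r ih =>
    have h : ∀ k : Fin N, X (Sum.inl k) ^ (r + 1) * esymZ {k} a =
        X (Sum.inl k) ^ r * esymZ {k} (a + 1) -
          esymZ ∅ (a + 1) * (X (Sum.inl k) ^ r * esymZ {k} 0) := by
      intro k
      have h0 : esymZ {k} 0 = 1 := coeff_revProd_singleton_zero _ k
      have h1 : X (Sum.inl k) * esymZ {k} a = esymZ {k} (a + 1) - esymZ ∅ (a + 1) :=
        mul_coeff_revProd_singleton _ k a
      rw [h0, pow_succ, mul_assoc, h1]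
      ring
    simp only [h, sub_mul, Finset.sum_sub_distrib, mul_assoc (esymZ ∅ (a + 1)),
      ← Finset.mul_sum]
    refine sub_mem (symbols_mono (by omega) (ih (a + 1)))
      (symbols_mono (by omega) (mul_mem_symbols (hz (a + 1)) (ih 0)))

/-- The monomial `z_k ^ r * λ_k ^ s` attached to the exponent `(r, s)`. -/
def pairMonomial (k : Fin N) (w : ℕ × ℕ) : Rzl N := X (Sum.inl k) ^ w.1 * X (Sum.inr k) ^ w.2

theorem pairMonomial_add (k : Fin N) (w w' : ℕ × ℕ) :
    pairMonomial k (w + w') = pairMonomial k w * pairMonomial k w' := by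
  simp only [pairMonomial, Prod.fst_add, Prod.snd_add, pow_add]
  ring

theorem sum_pairMonomial_mem_symbols (hz : ∀ n, esymZ ∅ n ∈ symbols B n)
    (hl : ∀ n, esymL ∅ n ∈ symbols B n)
    (hq : ∀ a b, ∑ k, esymZ {k} a * esymL {k} b ∈ symbols B (a + b)) (w : ℕ × ℕ) :
    ∑ k, pairMonomial k w ∈ symbols B (w.1 + w.2) := by
  have h := sum_mul_mem_symbols hz hl hq w.1 w.2 0 0
  have h1 : ∀ k : Fin N, esymZ {k} 0 = 1 := coeff_revProd_singleton_zero _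
  have h2 : ∀ k : Fin N, esymL {k} 0 = 1 := coeff_revProd_singleton_zero _
  simpa only [h1, h2, mul_one, add_zero, pairMonomial] using h

theorem sum_notMem_range_add_sum {n : ℕ} (e : Fin n ↪ Fin N) {M : Type*} [AddCommMonoid M]
    (g : Fin N → M) : ∑ i : {i // i ∉ Set.range e}, g i + ∑ j, g (e j) = ∑ k, g k := by
  classical
  rw [← Fintype.sum_subtype_add_sum_subtype (fun i => i ∈ Set.range e) g, add_comm]
  congr 1
  convert Equiv.sum_comp (Equiv.ofInjective e e.injective) fun i => g i
  rfl

theorem sum_embedding_succ {n : ℕ} (w : Fin (n + 1) → ℕ × ℕ) :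
    ∑ e : Fin (n + 1) ↪ Fin N, ∏ j, pairMonomial (e j) (w j) =
      (∑ k, pairMonomial k (w 0)) * ∑ e : Fin n ↪ Fin N, ∏ j, pairMonomial (e j) (w j.succ) -
      ∑ i, ∑ e : Fin n ↪ Fin N, ∏ j, pairMonomial (e j)
        (if j = i then w 0 + w j.succ else w j.succ) := by
  classical
  rw [← Equiv.sum_comp (Equiv.embeddingFinSucc n (Fin N)).symm, Fintype.sum_sigma,
    Finset.sum_comm (γ := Fin n), Finset.mul_sum, ← Finset.sum_sub_distrib]
  refine Finset.sum_congr rfl fun e _ => ?_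
  rw [← sum_notMem_range_add_sum e, add_mul, Finset.sum_mul, Finset.sum_mul]
  rw [eq_sub_iff_add_eq]
  congr 1
  · refine Finset.sum_congr rfl fun i _ => ?_
    rw [Fin.prod_univ_succ]
    simp
  · refine Finset.sum_congr rfl fun i _ => ?_
    rw [← Finset.mul_prod_erase _ _ (Finset.mem_univ i),
      ← Finset.mul_prod_erase _ _ (Finset.mem_univ i), if_pos rfl, pairMonomial_add, mul_assoc]
    congr 2
    refine Finset.prod_congr rfl fun j hj => ?_
    rw [if_neg (Finset.ne_of_mem_erase hj)]

theorem sum_embedding_mem_symbols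
    (hp : ∀ w : ℕ × ℕ, ∑ k, pairMonomial k w ∈ symbols B (w.1 + w.2)) (n : ℕ)
    (w : Fin n → ℕ × ℕ) :
    ∑ e : Fin n ↪ Fin N, ∏ j, pairMonomial (e j) (w j) ∈ symbols B (∑ j, ((w j).1 + (w j).2)) := by
  induction n with
  | zero => simpa using one_mem_symbols
  | succ n ih =>
    rw [sum_embedding_succ, Fin.sum_univ_succ]
    refine sub_mem (mul_mem_symbols (hp _) (ih _)) (sum_mem fun i _ => ?_)
    refine symbols_mono (le_of_eq ?_) (ih _)
    rw [← Finset.add_sum_erase _ _ (Finset.mem_univ i),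
      ← Finset.add_sum_erase Finset.univ (fun j => (w (Fin.succ j)).1 + (w (Fin.succ j)).2)
        (Finset.mem_univ i), if_pos rfl,
      Finset.sum_congr rfl fun j hj => by rw [if_neg (Finset.ne_of_mem_erase hj)]]
    simp only [Prod.fst_add, Prod.snd_add]
    ring

theorem sum_rename_monomial (m : Fin N ⊕ Fin N →₀ ℕ) (c : ℂ) :
    ∑ σ : Perm (Fin N), rename (Sum.map σ σ) (monomial m c) =
      c • ∑ e : Fin N ↪ Fin N, ∏ j, pairMonomial (e j) (m (Sum.inl j), m (Sum.inr j)) := by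
  rw [← Equiv.sum_comp (Equiv.embeddingEquivOfFinite (Fin N)).symm, Finset.smul_sum]
  refine Finset.sum_congr rfl fun σ _ => ?_
  rw [monomial_eq, Finsupp.prod_fintype _ _ (by simp), Fintype.prod_sum_type,
    ← Finset.prod_mul_distrib, smul_eq_C_mul, map_mul, map_prod, rename_C]
  congr 1
  refine Finset.prod_congr rfl fun j _ => ?_
  simp [pairMonomial]

theorem mem_symbols_of_rename_eq
    (hp : ∀ w : ℕ × ℕ, ∑ k, pairMonomial k w ∈ symbols B (w.1 + w.2)) {k : ℕ} {f : Rzl N}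
    (hf : f ∈ degLT N (k + 1)) (hsymm : ∀ σ : Perm (Fin N), rename (Sum.map σ σ) f = f) :
    f ∈ symbols B k := by
  have h1 : ∑ σ : Perm (Fin N), rename (Sum.map σ σ) f ∈ symbols B k := by
    rw [f.as_sum]
    simp only [map_sum]
    rw [Finset.sum_comm]
    refine sum_mem fun m hm => ?_
    rw [sum_rename_monomial]
    refine Submodule.smul_mem _ _ (symbols_mono ?_ (sum_embedding_mem_symbols hp N _))
    have := (le_totalDegree hm).trans (mem_degLT_succ.1 hf)
    rwa [Finsupp.sum_fintype _ _ (by simp), Fintype.sum_sum_type, ← Finset.sum_add_distrib] at this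
  simp only [hsymm, Finset.sum_const, Finset.card_univ] at h1
  rw [← Nat.cast_smul_eq_nsmul ℂ] at h1
  exact (Submodule.smul_mem_iff _ (Nat.cast_ne_zero.2 Fintype.card_ne_zero)).1 h1

theorem TL_apply_eq_self {F : V1 N} (hF : F ∈ V1SL N) {i j : Fin N} (h : i ≠ j) :
    TL N i j F = F := by
  rcases h.lt_or_gt with h | h
  · exact hF i j h
  · have h1 := hF j i h
    funext τ
    rw [TL_apply, swap_comm, ← TL_apply, h1]

theorem TR_apply_eq_self {F : V1 N} (hF : F ∈ V1SR N) {i j : Fin N} (h : i ≠ j) :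
    TR N i j F = F := by
  rcases h.lt_or_gt with h | h
  · exact hF i j h
  · have h1 := hF j i h
    funext τ
    rw [TR_apply, swap_comm, ← TR_apply, h1]

theorem apply_mul_left {F : V1 N} (hF : F ∈ V1SL N) (σ τ : Perm (Fin N)) :
    F (σ * τ) = rename (Sum.map id σ) (F τ) := by
  induction σ using Perm.swap_induction_on with
  | one => simp
  | swap_mul σ i j hij ih =>
    have h := congrFun (TL_apply_eq_self hF hij) (swap i j * σ * τ)
    rw [TL_apply, mul_assoc, swap_mul_self_mul, ih, rename_rename, Sum.map_comp_map] at h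
    rw [mul_assoc, ← h]
    rfl

theorem apply_mul_inv {F : V1 N} (hF : F ∈ V1SR N) (σ τ : Perm (Fin N)) :
    F (τ * σ⁻¹) = rename (Sum.map σ id) (F τ) := by
  induction σ using Perm.swap_induction_on with
  | one => simp
  | swap_mul σ i j hij ih =>
    have h := congrFun (TR_apply_eq_self hF hij) (τ * (swap i j * σ)⁻¹)
    rw [TR_apply, mul_inv_rev, swap_inv, ← mul_assoc, mul_swap_mul_self, ih, rename_rename,
      Sum.map_comp_map] at h
    rw [mul_inv_rev, swap_inv, ← mul_assoc, ← h]
    rfl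

theorem rename_apply_one {F : V1 N} (hF : F ∈ WW N) (σ : Perm (Fin N)) :
    rename (Sum.map σ σ) (F 1) = F 1 := by
  have h1 := apply_mul_left hF.1 σ 1
  have h2 := apply_mul_inv hF.2 σ (σ * 1)
  rw [h1, rename_rename, Sum.map_comp_map] at h2
  simpa using h2.symm

theorem one_mem_WW : (fun _ => (1 : Rzl N)) ∈ WW N :=
  ⟨fun i j _ => funext fun τ => by rw [TL_apply, map_one],
    fun i j _ => funext fun τ => by rw [TR_apply, map_one]⟩

theorem sub_mem_WW {F G : V1 N} (hF : F ∈ WW N) (hG : G ∈ WW N) : F - G ∈ WW N :=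
  ⟨fun i j h => by rw [map_sub, hF.1 i j h, hG.1 i j h],
    fun i j h => by rw [map_sub, hF.2 i j h, hG.2 i j h]⟩

theorem apply_mem_WW {x : Module.End ℂ (V1 N)} (hL : ∀ i j, x * TL N i j = TL N i j * x)
    (hR : ∀ i j, x * TR N i j = TR N i j * x) {F : V1 N} (hF : F ∈ WW N) : x F ∈ WW N :=
  ⟨fun i j h => by rw [← Module.End.mul_apply, ← hL, Module.End.mul_apply, hF.1 i j h],
    fun i j h => by rw [← Module.End.mul_apply, ← hR, Module.End.mul_apply, hF.2 i j h]⟩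

theorem exists_apply_one_eq
    (hp : ∀ w : ℕ × ℕ, ∑ k, pairMonomial k w ∈ symbols B (w.1 + w.2))
    (hB : ∀ x ∈ B, ∀ F ∈ WW N, x F ∈ WW N) (k : ℕ) :
    ∀ F ∈ WW N, F 1 ∈ degLT N k → ∃ x ∈ B, x (fun _ => (1 : Rzl N)) = F := by
  induction k with
  | zero =>
    intro F hF h
    have h0 : F 1 = 0 := (mem_degLT.1 h).resolve_right (Nat.not_lt_zero _)
    refine ⟨0, zero_mem _, funext fun τ => ?_⟩
    have := apply_mul_left hF.1 τ 1
    rw [mul_one, h0, map_zero] at this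
    exact this.symm
  | succ k ih =>
    intro F hF h
    obtain ⟨b, hb, hs⟩ := mem_symbols_of_rename_eq hp h (rename_apply_one hF)
    have h1 := hs.2 0 (fun _ => 1) (fun _ => by rw [mem_degLT_succ, totalDegree_one]) 1
    have h2 : (F - b fun _ => (1 : Rzl N)) 1 ∈ degLT N k := by
      rw [Pi.sub_apply, ← neg_sub]
      simpa using neg_mem h1
    obtain ⟨c, hc, hc1⟩ := ih _ (sub_mem_WW hF (hB b hb _ one_mem_WW)) h2
    exact ⟨c + b, add_mem hc hb, by rw [LinearMap.add_apply, hc1, sub_add_cancel]⟩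

end Bethe

set_option synthInstance.maxHeartbeats 1000000 in
/-- The Bethe algebra `B` preserves `W = V_1^{S^L} ∩ V_1^{S^R}`, and
`b ↦ b(Σ_σ ε_σ)` is a `ℂ`-linear isomorphism from `B` onto `W`; thus `W` is a
cyclic `B`-module isomorphic to the regular representation. -/
theorem stmt15 (N : ℕ) (hN : 0 < N)
    (bb : Fin (N + 1) → Fin (N + 1) → Module.End ℂ (V1 N))
    (hb : ∀ u v : ℂ, PB N u v =
      ∑ i : Fin (N + 1), ∑ j : Fin (N + 1),
        (u ^ (N - (i : ℕ)) * v ^ (N - (j : ℕ))) • bb i j) :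
    (∀ (i j : Fin (N + 1)) (F : V1 N), F ∈ WW N → bb i j F ∈ WW N) ∧
    Set.InjOn (fun x : Module.End ℂ (V1 N) => x (fun _ => (1 : Rzl N)))
      (Algebra.adjoin ℂ {x : Module.End ℂ (V1 N) | ∃ i j : Fin (N + 1), x = bb i j} :
        Set (Module.End ℂ (V1 N))) ∧
    (fun x : Module.End ℂ (V1 N) => x (fun _ => (1 : Rzl N))) ''
      (Algebra.adjoin ℂ {x : Module.End ℂ (V1 N) | ∃ i j : Fin (N + 1), x = bb i j} :
        Set (Module.End ℂ (V1 N))) = WW N := by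
  set B := Algebra.adjoin ℂ {x : Module.End ℂ (V1 N) | ∃ i j : Fin (N + 1), x = bb i j}
  have hgen : ∀ i j, bb i j ∈ B := fun i j => Algebra.subset_adjoin ⟨i, j, rfl⟩
  have hcomm : ∀ T : Module.End ℂ (V1 N), (∀ u v, PB N u v * T = T * PB N u v) →
      ∀ x ∈ B, x * T = T * x := by
    intro T hT x hx
    refine (Algebra.commute_of_mem_adjoin_of_forall_mem_commute hx ?_).symm.eq
    rintro _ ⟨i, j, rfl⟩
    exact (commute_coeff hb hT i j).symm
  have hW : ∀ x ∈ B, ∀ F ∈ WW N, x F ∈ WW N := fun x hx F hF =>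
    apply_mem_WW (fun i j => hcomm _ (fun u v => PB_commute_TL u v i j) x hx)
      (fun i j => hcomm _ (fun u v => PB_commute_TR u v i j) x hx) hF
  refine ⟨fun i j F hF => hW _ (hgen i j) F hF, fun x hx y hy hxy => ?_, Set.Subset.antisymm ?_ ?_⟩
  · have hz : x - y ∈ B := sub_mem hx hy
    refine sub_eq_zero.1 (eq_zero_of_apply_one_eq_zero
      (fun r => hcomm _ (fun u v => PB_commute_mulDiag_const u v r) _ hz)
      (fun k => hcomm _ (fun u v => PB_commute_gaudin u v k) _ hz) ?_)
    rw [LinearMap.sub_apply]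
    exact sub_eq_zero.2 hxy
  · rintro _ ⟨x, hx, rfl⟩
    exact hW x hx _ one_mem_WW
  · intro F hF
    have hbb := eq_betheCoeff hb
    have hp := sum_pairMonomial_mem_symbols (esymZ_mem_symbols hbb hgen)
      (esymL_mem_symbols hbb hgen) (sum_esymZ_mul_esymL_mem_symbols hbb hgen)
    exact exists_apply_one_eq hp hW _ F hF (mem_degLT_succ.2 le_rfl)
end
end

section
/- The operators b̄_ij map W into W and map I_{a,b}·V_1 ∩ W into itself, and hence induce operators on the quotient space M_{a,b} = W / (I_{a,b}·V_1 ∩ W). If v, w ∈ M_{a,b} are nonzero vectors for which there exist scalars β_ij ∈ C with b̄_ij v = β_ij v and b̄_ij w = β_ij w for all 0 ≤ i,j ≤ N, then w = c·v for some nonzero c ∈ C. (Joint eigenvectors of the Bethe algebra with equal eigenvalues are proportional.) -/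
open MvPolynomial

noncomputable section

/-- The ideal `I_{a,b} ⊂ ℂ[z,λ]` generated by `e_i(z) − a_i` and `e_i(λ) − b_i`. -/
def Iab (N : ℕ) (a b : Fin N → ℂ) : Ideal (Rzl N) :=
  Ideal.span {x : Rzl N | ∃ i : Fin N,
    (x = rename Sum.inl (esymm (Fin N) ℂ ((i : ℕ) + 1)) - C (a i) ∨
     x = rename Sum.inr (esymm (Fin N) ℂ ((i : ℕ) + 1)) - C (b i))}

/-- The submodule `I_{a,b}·V_1` of the free module `V_1`: elements all of whose
coordinates lie in `I_{a,b}`. -/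
def IV (N : ℕ) (a b : Fin N → ℂ) : Set (V1 N) :=
  {F | ∀ τ : Equiv.Perm (Fin N), F τ ∈ Iab N a b}

/-! ### Extracting coefficients of polynomial families -/

theorem Submodule.mem_of_forall_sum_pow_smul_mem {V : Type*} [AddCommGroup V] [Module ℂ V]
    (P : Submodule ℂ V) {n : ℕ} (x : Fin n → V)
    (h : ∀ u : ℂ, ∑ i : Fin n, u ^ (i : ℕ) • x i ∈ P) (i : Fin n) : x i ∈ P := by
  classical
  set A : Matrix (Fin n) (Fin n) ℂ := Matrix.vandermonde (fun i : Fin n => ((i : ℕ) : ℂ)) with hA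
  have hdet : IsUnit A.det := by
    rw [isUnit_iff_ne_zero, hA, Matrix.det_vandermonde_ne_zero_iff]
    intro a b hab
    exact Fin.ext (Nat.cast_injective (R := ℂ) hab)
  have key : x i = ∑ t, A⁻¹ i t • ∑ j, A t j • x j := by
    simp_rw [Finset.smul_sum, smul_smul]
    rw [Finset.sum_comm]
    simp_rw [← Finset.sum_smul]
    have h1 : ∀ j, ∑ t, A⁻¹ i t * A t j = if i = j then 1 else 0 := by
      intro j
      rw [← Matrix.mul_apply, Matrix.nonsing_inv_mul _ hdet, Matrix.one_apply]
    simp [h1]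
  rw [key]
  refine P.sum_mem fun t _ => P.smul_mem _ ?_
  simpa [hA, Matrix.vandermonde_apply] using h (t : ℕ)

theorem Submodule.mem_of_forall_sum_pow_sub_smul_mem {V : Type*} [AddCommGroup V] [Module ℂ V]
    (P : Submodule ℂ V) {n : ℕ} (x : Fin (n + 1) → V)
    (h : ∀ u : ℂ, ∑ i : Fin (n + 1), u ^ (n - (i : ℕ)) • x i ∈ P) (i : Fin (n + 1)) : x i ∈ P := by
  have := P.mem_of_forall_sum_pow_smul_mem (fun i => x (Fin.rev i)) (fun u => by
    rw [← Equiv.sum_comp Fin.revPerm]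
    convert h u using 4 with i
    · simp [Fin.val_rev]
    · simp) (Fin.rev i)
  simpa using this

theorem Submodule.mem_of_forall_sum_sum_pow_smul_mem {V : Type*} [AddCommGroup V] [Module ℂ V]
    (P : Submodule ℂ V) {n : ℕ} (x : Fin (n + 1) → Fin (n + 1) → V)
    (h : ∀ u v : ℂ, ∑ i : Fin (n + 1), ∑ j : Fin (n + 1), (u ^ (n - (i : ℕ)) * v ^ (n - (j : ℕ))) • x i j ∈ P)
    (i j : Fin (n + 1)) : x i j ∈ P := by
  refine P.mem_of_forall_sum_pow_sub_smul_mem (x i) (fun v => ?_) j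
  refine P.mem_of_forall_sum_pow_sub_smul_mem
    (fun i => ∑ j : Fin (n + 1), v ^ (n - (j : ℕ)) • x i j) (fun u => ?_) i
  simpa [Finset.smul_sum, smul_smul] using h u v

/-! ### A nondegeneracy criterion for triangular ideals -/

section Triangular

variable {σ : Type*} [LinearOrder σ] [Fintype σ]

theorem monomial_mem_sup_restrictSupport (I : Ideal (MvPolynomial σ ℂ)) (δ : σ →₀ ℕ)
    (hred : ∀ i, ∃ c : ℕ → MvPolynomial σ ℂ, (∀ t, c t ∈ supported ℂ (Set.Ioi i)) ∧
      X i ^ (δ i + 1) + ∑ t ∈ Finset.range (δ i + 1), c t * X i ^ t ∈ I)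
    (m : σ →₀ ℕ) :
    monomial m (1 : ℂ) ∈ I.restrictScalars ℂ ⊔ restrictSupport ℂ {m | m ≤ δ} := by
  classical
  set S := I.restrictScalars ℂ ⊔ restrictSupport ℂ {m | m ≤ δ} with hS
  have wf : WellFounded (fun m m' : σ →₀ ℕ => toLex (⇑m) < toLex (⇑m')) :=
    InvImage.wf (fun m : σ →₀ ℕ => toLex (⇑m)) wellFounded_lt
  induction m using wf.induction with
  | _ m ih =>
  by_cases hm : m ≤ δ
  · exact Submodule.mem_sup_right (by simp [monomial_mem_restrictSupport, hm])
  obtain ⟨i, hi⟩ : ∃ i, δ i < m i := by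
    by_contra! hcon
    exact hm hcon
  obtain ⟨c, hc, hrel⟩ := hred i
  set m1 := m - Finsupp.single i (δ i + 1) with hm1
  have hm' : m = m1 + Finsupp.single i (δ i + 1) := by
    ext j
    by_cases hj : j = i
    · subst hj; simp [hm1]; omega
    · simp [hm1, Finsupp.single_eq_of_ne hj]
  have e1 : monomial m (1 : ℂ) =
      (X i ^ (δ i + 1) + ∑ t ∈ Finset.range (δ i + 1), c t * X i ^ t) * monomial m1 1 -
        ∑ t ∈ Finset.range (δ i + 1), c t * (X i ^ t * monomial m1 1) := by
    rw [add_mul, Finset.sum_mul]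
    simp_rw [mul_assoc]
    rw [add_sub_cancel_right, hm', X_pow_eq_monomial, monomial_mul, add_comm m1]
    simp [hm1]
  rw [e1]
  refine S.sub_mem (Submodule.mem_sup_left (I.mul_mem_right _ hrel)) (S.sum_mem fun t ht => ?_)
  rw [(c t).as_sum, Finset.sum_mul]
  refine S.sum_mem fun e he => ?_
  rw [X_pow_eq_monomial, monomial_mul, monomial_mul, mul_one, mul_one,
    ← mul_one ((c t).coeff e), ← smul_eq_mul, ← smul_monomial]
  refine S.smul_mem _ (ih _ ?_)
  have hsupp : ∀ j ≤ i, e j = 0 := by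
    intro j hj
    by_contra hne
    have : j ∈ (c t).vars := (mem_vars_iff_mem_support j).2 ⟨e, he, by simpa using hne⟩
    exact absurd (mem_supported.1 (hc t) this) (not_lt.2 hj)
  refine ⟨i, fun j hj => ?_, ?_⟩
  · simp [hm1, hsupp j hj.le, Finsupp.single_eq_of_ne hj.ne]
  · have := Finset.mem_range.1 ht
    simp [hm1, hsupp i le_rfl]
    omega

theorem exists_apply_mul_ne_zero_of_triangular (I : Ideal (MvPolynomial σ ℂ))
    (l : MvPolynomial σ ℂ →ₗ[ℂ] ℂ) (δ : σ →₀ ℕ) (hI : ∀ x ∈ I, l x = 0)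
    (h0 : l (monomial δ 1) ≠ 0)
    (hlt : ∀ (γ : σ →₀ ℕ) (i : σ), (∀ j < i, γ j = δ j) → γ i < δ i → l (monomial γ 1) = 0)
    (hred : ∀ i, ∃ c : ℕ → MvPolynomial σ ℂ, (∀ t, c t ∈ supported ℂ (Set.Ioi i)) ∧
      X i ^ (δ i + 1) + ∑ t ∈ Finset.range (δ i + 1), c t * X i ^ t ∈ I)
    {f : MvPolynomial σ ℂ} (hf : f ∉ I) : ∃ g, l (f * g) ≠ 0 := by
  classical
  have hf' : f ∈ I.restrictScalars ℂ ⊔ restrictSupport ℂ {m | m ≤ δ} := by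
    rw [f.as_sum]
    refine Submodule.sum_mem _ fun m _ => ?_
    rw [← mul_one (f.coeff m), ← smul_eq_mul, ← smul_monomial]
    exact Submodule.smul_mem _ _ (monomial_mem_sup_restrictSupport I δ hred m)
  obtain ⟨x, hx, y, hy, rfl⟩ := Submodule.mem_sup.1 hf'
  have hx : x ∈ I := hx
  have hy0 : y ≠ 0 := by
    rintro rfl
    exact hf (by simpa using hx)
  obtain ⟨α, hα, hmax⟩ := Finset.exists_max_image y.support (fun m => toLex (⇑m))
    (support_nonempty.2 hy0)
  have hαδ : α ≤ δ := ((mem_restrictSupport_iff ℂ).1 hy) hα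
  refine ⟨monomial (δ - α) 1, ?_⟩
  have e1 : l ((x + y) * monomial (δ - α) 1) = y.coeff α * l (monomial δ 1) := by
    rw [add_mul, map_add, hI _ (I.mul_mem_right _ hx), zero_add]
    conv_lhs => rw [y.as_sum, Finset.sum_mul, map_sum]
    have hterm : ∀ m, l (monomial m (y.coeff m) * monomial (δ - α) 1) =
        y.coeff m * l (monomial (m + (δ - α)) 1) := by
      intro m
      rw [monomial_mul, ← smul_eq_mul (y.coeff m) (l _), ← map_smul, smul_monomial, smul_eq_mul]
    simp_rw [hterm]
    rw [Finset.sum_eq_single α, add_tsub_cancel_of_le hαδ]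
    · intro m hm hne
      obtain ⟨i, hi, hi'⟩ : toLex (⇑m) < toLex (⇑α) :=
        lt_of_le_of_ne (hmax m hm) (fun h => hne (DFunLike.coe_injective (toLex.injective h)))
      rw [hlt _ i, mul_zero]
      · intro j hj
        have h1 : m j = α j := hi j hj
        have h2 := hαδ j
        simp only [Finsupp.add_apply, Finsupp.tsub_apply]
        omega
      · have h1 : m i < α i := hi'
        have h2 := hαδ i
        simp only [Finsupp.add_apply, Finsupp.tsub_apply]
        omega
    · exact fun h => absurd hα h
  rw [e1]
  exact mul_ne_zero (mem_support_iff.1 hα) h0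

end Triangular

/-! ### The alternating functional attached to prescribed elementary symmetric functions -/

/-- The monic polynomial `∏ (x + t_i)` with prescribed elementary symmetric functions
`e_{i+1}(t) = a i`. -/
def polyOfEsymm {N : ℕ} (a : Fin N → ℂ) : Polynomial ℂ :=
  Polynomial.X ^ N + ∑ i : Fin N, Polynomial.C (a i) * Polynomial.X ^ (N - ((i : ℕ) + 1))

theorem degree_sum_C_mul_X_pow_sub_lt {N : ℕ} (a : Fin N → ℂ) :
    (∑ i : Fin N, Polynomial.C (a i) * Polynomial.X ^ (N - ((i : ℕ) + 1))).degree < (N : WithBot ℕ) := by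
  refine (Polynomial.degree_sum_le _ _).trans_lt
    ((Finset.sup_lt_iff (WithBot.bot_lt_coe N)).2 fun k _ => ?_)
  have h : N - ((k : ℕ) + 1) < N := by omega
  exact (Polynomial.degree_C_mul_X_pow_le _ _).trans_lt (Nat.cast_lt.2 h)

theorem polyOfEsymm_monic {N : ℕ} (a : Fin N → ℂ) : (polyOfEsymm a).Monic :=
  Polynomial.monic_X_pow_add (degree_sum_C_mul_X_pow_sub_lt a)

theorem natDegree_polyOfEsymm {N : ℕ} (a : Fin N → ℂ) : (polyOfEsymm a).natDegree = N := by
  apply Polynomial.natDegree_eq_of_degree_eq_some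
  rw [polyOfEsymm, Polynomial.degree_add_eq_left_of_degree_lt, Polynomial.degree_X_pow]
  rw [Polynomial.degree_X_pow]
  exact degree_sum_C_mul_X_pow_sub_lt a

theorem eval_polyOfEsymm {N : ℕ} (a : Fin N → ℂ) (x : ℂ) :
    (polyOfEsymm a).eval x = x ^ N + ∑ i : Fin N, a i * x ^ (N - ((i : ℕ) + 1)) := by
  simp [polyOfEsymm, Polynomial.eval_finsetSum]

theorem prod_X_add_C_eq_map_polyOfEsymm {N : ℕ} {A : Type*} [CommRing A] [Algebra ℂ A]
    (φ : MvPolynomial (Fin N) ℂ →ₐ[ℂ] A) (a : Fin N → ℂ)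
    (h : ∀ i : Fin N, φ (esymm (Fin N) ℂ ((i : ℕ) + 1)) = algebraMap ℂ A (a i)) :
    ∏ j, (Polynomial.X + Polynomial.C (φ (X j))) = (polyOfEsymm a).map (algebraMap ℂ A) := by
  have := congrArg (Polynomial.map (φ : MvPolynomial (Fin N) ℂ →+* A))
    (prod_C_add_X_eq_sum_esymm ℂ (Fin N))
  rw [Polynomial.map_prod] at this
  simp only [Polynomial.map_add, Polynomial.map_X, Polynomial.map_C, RingHom.coe_coe] at this
  rw [this, Fintype.card_fin, Finset.sum_range_succ', polyOfEsymm, Finset.sum_range]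
  simp [Polynomial.map_sum, h, add_comm]

theorem exists_alternating_function {N : ℕ} (a : Fin N → ℂ) :
    ∃ D : (Fin N → ℕ) → ℂ,
      (∀ (τ : Equiv.Perm (Fin N)) γ, D (γ ∘ τ) = (Equiv.Perm.sign τ : ℤ) * D γ) ∧
      (∀ γ i j, i ≠ j → γ i = γ j → D γ = 0) ∧
      D (fun i => i) ≠ 0 ∧
      ∀ γ (k : Fin N), ∑ S ∈ Finset.powersetCard ((k : ℕ) + 1) Finset.univ,
        D (fun i => γ i + if i ∈ S then 1 else 0) = a k * D γ := by
  classical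
  set q := polyOfEsymm a with hq
  have hm : q.Monic := polyOfEsymm_monic a
  let pb := AdjoinRoot.powerBasis hm.ne_zero
  have hdim : pb.dim = N := (AdjoinRoot.powerBasis_dim hm.ne_zero).trans (natDegree_polyOfEsymm a)
  let b : Module.Basis (Fin N) ℂ (AdjoinRoot q) := pb.basis.reindex (finCongr hdim)
  let ρ : AdjoinRoot q := AdjoinRoot.root q
  have : Module.Finite ℂ (AdjoinRoot q) := Module.Finite.of_basis b
  have hgen : pb.gen = ρ := AdjoinRoot.powerBasis_gen hm.ne_zero
  have hb : ∀ i, b i = ρ ^ (i : ℕ) := by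
    intro i
    simp [b, hgen]
  have hchar : (Algebra.lmul ℂ (AdjoinRoot q) ρ).charpoly = q := by
    rw [← LinearMap.charpoly_toMatrix _ pb.basis, ← Algebra.leftMulMatrix_apply, ← hgen,
      charpoly_leftMulMatrix]
    exact AdjoinRoot.minpoly_powerBasis_gen_of_monic hm
  have hmul : ∀ (x : ℂ) (v : Fin N → AdjoinRoot q),
      b.det (fun i => -ρ * v i + x • v i) = q.eval x * b.det v := by
    intro x v
    have h1 := LinearMap.eval_charpoly (Algebra.lmul ℂ (AdjoinRoot q) ρ) x
    rw [hchar] at h1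
    rw [h1, ← Module.Basis.det_comp]
    congr 1
    funext i
    simp [Algebra.smul_def]
    ring
  refine ⟨fun γ => b.det fun i => (-ρ) ^ γ i, ?_, ?_, ?_, ?_⟩
  · intro τ γ
    have := b.det.map_perm (fun i => (-ρ) ^ γ i) τ
    simpa [Function.comp_def, Units.smul_def] using this
  · intro γ i j hij h
    exact b.det.map_eq_zero_of_eq _ (by simp [h]) hij
  · have h1 : (fun i : Fin N => (-ρ) ^ (i : ℕ)) = fun i : Fin N => ((-1 : ℂ) ^ (i : ℕ)) • b i := by
      funext i
      rw [hb, neg_pow, Algebra.smul_def]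
      simp
    change b.det (fun i : Fin N => (-ρ) ^ (i : ℕ)) ≠ 0
    rw [h1]
    erw [b.det.toMultilinearMap.map_smul_univ (fun i : Fin N => (-1 : ℂ) ^ (i : ℕ)) b]
    have h2 : b.det.toMultilinearMap b = 1 := b.det_self
    rw [h2, smul_eq_mul, mul_one]
    exact Finset.prod_ne_zero_iff.2 fun i _ => pow_ne_zero _ (by norm_num)
  · intro γ k
    set D : (Fin N → ℕ) → ℂ := fun γ => b.det fun i => (-ρ) ^ γ i with hD
    have hexp : ∀ x : ℂ, ∑ S : Finset (Fin N),
        x ^ (N - S.card) * D (fun i => γ i + if i ∈ S then 1 else 0) = q.eval x * D γ := by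
      intro x
      rw [← hmul x (fun i => (-ρ) ^ γ i)]
      have h3 := b.det.map_add_univ (fun i => -ρ * (-ρ) ^ γ i) (fun i => x • (-ρ) ^ γ i)
      refine Eq.trans ?_ h3.symm
      refine Finset.sum_congr rfl fun S _ => ?_
      have h4 : S.piecewise (fun i => -ρ * (-ρ) ^ γ i) (fun i => x • (-ρ) ^ γ i) =
          fun i => (if i ∈ S then (1 : ℂ) else x) • (-ρ) ^ (γ i + if i ∈ S then 1 else 0) := by
        funext i
        by_cases hi : i ∈ S
        · simp [hi, pow_succ']
        · simp [hi]
      rw [h4]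
      have h5 := b.det.toMultilinearMap.map_smul_univ (fun i => if i ∈ S then (1 : ℂ) else x)
        (fun i => (-ρ) ^ (γ i + if i ∈ S then 1 else 0))
      refine Eq.trans ?_ h5.symm
      rw [Finset.prod_ite, Finset.prod_const_one, one_mul, Finset.prod_const, smul_eq_mul]
      congr 2
      rw [Finset.filter_not, Finset.filter_mem_eq_inter, Finset.univ_inter,
        ← Finset.compl_eq_univ_sdiff, Finset.card_compl, Fintype.card_fin]
    have hsplit : ∀ x : ℂ, ∑ k : Fin (N + 1), x ^ (N - (k : ℕ)) •
        (∑ S ∈ Finset.powersetCard (k : ℕ) Finset.univ,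
          D (fun i => γ i + if i ∈ S then 1 else 0) -
            (Fin.cons 1 a : Fin (N + 1) → ℂ) k * D γ) = 0 := by
      intro x
      have h6 := hexp x
      rw [← Finset.powerset_univ, Finset.sum_powerset, Finset.card_univ, Fintype.card_fin,
        Finset.sum_range, hq, eval_polyOfEsymm] at h6
      simp_rw [smul_sub, Finset.sum_sub_distrib, sub_eq_zero]
      refine Eq.trans (Finset.sum_congr rfl fun k _ => ?_) (h6.trans ?_)
      · rw [smul_eq_mul, Finset.mul_sum]
        refine Finset.sum_congr rfl fun S hS => ?_
        rw [(Finset.mem_powersetCard.1 hS).2]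
      · rw [Fin.sum_univ_succ, add_mul, Finset.sum_mul]
        simp only [Fin.cons_zero, Fin.cons_succ, smul_eq_mul, Fin.val_zero, Fin.val_succ]
        congr 1
        · simp
        · exact Finset.sum_congr rfl fun i _ => by ring
    have := (⊥ : Submodule ℂ ℂ).mem_of_forall_sum_pow_sub_smul_mem _
      (fun x => (Submodule.mem_bot ℂ).2 (hsplit x)) k.succ
    simpa [sub_eq_zero] using this

/-! ### The ideal `I_{a,b}` and an alternating nondegenerate functional on its quotient -/

theorem exists_monic_relation_of_prod_eq_map {N : ℕ} {A : Type*} [CommRing A] [Algebra ℂ A]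
    (z : Fin N → A) (q : Polynomial ℂ)
    (hq : ∏ j, (Polynomial.X + Polynomial.C (z j)) = q.map (algebraMap ℂ A)) (i : Fin N) :
    ∃ c : ℕ → A, (∀ t, c t ∈ Algebra.adjoin ℂ (z '' Set.Ioi i)) ∧
      z i ^ ((i : ℕ) + 1) + ∑ t ∈ Finset.range ((i : ℕ) + 1), c t * z i ^ t = 0 := by
  classical
  let P : ℕ → Polynomial A := fun n =>
    ∏ j with (j : Fin N).val < n, (Polynomial.X + Polynomial.C (z j))
  have hPmonic : ∀ n, (P n).Monic := fun n =>
    Polynomial.monic_prod_of_monic _ _ fun j _ => Polynomial.monic_X_add_C _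
  have hPdeg : ∀ n, (P n).natDegree ≤ n := by
    intro n
    refine (Polynomial.natDegree_prod_le _ _).trans
      ((Finset.sum_le_card_nsmul _ _ 1 fun j _ => ?_).trans ?_)
    · exact (Polynomial.natDegree_add_C).trans_le Polynomial.natDegree_X_le
    · rw [smul_eq_mul, mul_one]
      calc _ ≤ (Finset.range n).card :=
            Finset.card_le_card_of_injOn Fin.val (fun j hj => by simpa using hj)
              Fin.val_injective.injOn
        _ = n := Finset.card_range n
  have hsucc : ∀ n (hn : n < N), P (n + 1) = P n * (Polynomial.X + Polynomial.C (z ⟨n, hn⟩)) := by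
    intro n hn
    have : (Finset.univ.filter fun j : Fin N => j.val < n + 1) =
        insert ⟨n, hn⟩ (Finset.univ.filter fun j : Fin N => j.val < n) := by
      ext j
      simp [Fin.ext_iff]
      omega
    simp only [P]
    rw [this, Finset.prod_insert (by simp), mul_comm]
  have hcoeff : ∀ k ≤ N, ∀ t, (P (N - k)).coeff t ∈
      Algebra.adjoin ℂ (z '' {j | N - k ≤ (j : ℕ)}) := by
    intro k
    induction k with
    | zero =>
      intro _ t
      have : P N = q.map (algebraMap ℂ A) := by
        rw [← hq]
        exact Finset.prod_congr (by ext j; simp) fun _ _ => rfl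
      simp only [Nat.sub_zero]
      rw [this, Polynomial.coeff_map]
      exact Subalgebra.algebraMap_mem _ _
    | succ k ih =>
      intro hk
      set n := N - (k + 1) with hn
      have hn1 : N - k = n + 1 := by omega
      have hnN : n < N := by omega
      have key : ∀ s t, n + 1 ≤ t + s → (P n).coeff t ∈
          Algebra.adjoin ℂ (z '' {j | n ≤ (j : ℕ)}) := by
        intro s
        induction s with
        | zero =>
          intro t ht
          rw [Polynomial.coeff_eq_zero_of_natDegree_lt ((hPdeg n).trans_lt (by omega))]
          exact Subalgebra.zero_mem _
        | succ s ihs =>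
          intro t ht
          have h1 : (P n).coeff t = (P (n + 1)).coeff (t + 1) -
              z ⟨n, hnN⟩ * (P n).coeff (t + 1) := by
            rw [hsucc n hnN, mul_add, Polynomial.coeff_add, Polynomial.coeff_mul_X,
              Polynomial.coeff_mul_C]
            ring
          rw [h1]
          refine Subalgebra.sub_mem _ ?_ (Subalgebra.mul_mem _ ?_ (ihs _ (by omega)))
          · have h2 := ih (by omega) (t + 1)
            rw [hn1] at h2
            refine Algebra.adjoin_mono (Set.image_mono fun j hj => ?_) h2
            exact Nat.le_of_succ_le hj
          · exact Algebra.subset_adjoin ⟨⟨n, hnN⟩, le_refl n, rfl⟩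
      exact fun t => key (n + 1) t (by omega)
  have hroot : (P (i + 1)).eval (-z i) = 0 := by
    rw [hsucc i i.2]
    simp
  have hdeg : (P (i + 1)).natDegree < i + 1 + 1 := (hPdeg _).trans_lt (Nat.lt_succ_self _)
  rw [Polynomial.eval_eq_sum_range' hdeg, Finset.sum_range_succ] at hroot
  have hlead : (P (i + 1)).coeff (i + 1) = 1 := by
    have h3 : P (i + 1) = ∏ j ∈ Finset.Iic i, (Polynomial.X + Polynomial.C (z j)) :=
      Finset.prod_congr (by
        ext j
        simp only [Finset.mem_filter, Finset.mem_univ, true_and, Finset.mem_Iic, Fin.le_def]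
        omega) fun _ _ => rfl
    by_cases hA : Nontrivial A
    · have h4 : (P (i + 1)).natDegree = i + 1 := by
        rw [h3, Polynomial.natDegree_prod_of_monic _ _ fun j _ => Polynomial.monic_X_add_C _]
        simp
      have := (hPmonic (i + 1)).coeff_natDegree
      rwa [h4] at this
    · rw [not_nontrivial_iff_subsingleton] at hA
      exact Subsingleton.elim _ _
  refine ⟨fun t => (-1) ^ ((i : ℕ) + 1) * ((-1) ^ t * (P (i + 1)).coeff t), fun t => ?_, ?_⟩
  · have hmem := hcoeff (N - (i + 1)) (by omega) t
    have h5 : N - (N - ((i : ℕ) + 1)) = i + 1 := by omega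
    rw [h5] at hmem
    have hone : ∀ k, ((-1 : A)) ^ k ∈ Algebra.adjoin ℂ (z '' Set.Ioi i) := fun k =>
      Subalgebra.pow_mem _ (Subalgebra.neg_mem _ (Subalgebra.one_mem _)) _
    exact Subalgebra.mul_mem _ (hone _) (Subalgebra.mul_mem _ (hone _) hmem)
  · rw [hlead, one_mul] at hroot
    have h6 := congrArg (fun x => (-1 : A) ^ ((i : ℕ) + 1) * x) hroot
    simp only [mul_zero, mul_add] at h6
    rw [← h6, add_comm, Finset.mul_sum]
    congr 1
    · refine Finset.sum_congr rfl fun t _ => ?_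
      rw [neg_pow (z i)]
      ring
    · rw [neg_pow (z i), ← mul_assoc, ← mul_pow]
      simp

/-- The substitution permuting the `z`-variables by `τ`. -/
def permZ (N : ℕ) (τ : Equiv.Perm (Fin N)) : Rzl N →ₐ[ℂ] Rzl N := rename (Sum.map τ id)

/-- The substitution permuting the `λ`-variables by `τ`. -/
def permL (N : ℕ) (τ : Equiv.Perm (Fin N)) : Rzl N →ₐ[ℂ] Rzl N := rename (Sum.map id τ)

theorem permL_one {N : ℕ} (x : Rzl N) : permL N 1 x = x := by
  rw [permL, Equiv.Perm.coe_one, Sum.map_id_id, rename_id_apply]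

theorem mk_prod_X_add_C_inl {N : ℕ} (a b : Fin N → ℂ) :
    ∏ j, (Polynomial.X + Polynomial.C (Ideal.Quotient.mkₐ ℂ (Iab N a b) (X (Sum.inl j)))) =
      (polyOfEsymm a).map (algebraMap ℂ (Rzl N ⧸ Iab N a b)) := by
  have := prod_X_add_C_eq_map_polyOfEsymm
    ((Ideal.Quotient.mkₐ ℂ (Iab N a b)).comp (rename Sum.inl)) a (fun i => by
      have h : rename Sum.inl (esymm (Fin N) ℂ ((i : ℕ) + 1)) - C (a i) ∈ Iab N a b :=
        Ideal.subset_span ⟨i, Or.inl rfl⟩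
      exact Ideal.Quotient.eq.2 h)
  simpa using this

theorem mk_prod_X_add_C_inr {N : ℕ} (a b : Fin N → ℂ) :
    ∏ j, (Polynomial.X + Polynomial.C (Ideal.Quotient.mkₐ ℂ (Iab N a b) (X (Sum.inr j)))) =
      (polyOfEsymm b).map (algebraMap ℂ (Rzl N ⧸ Iab N a b)) := by
  have := prod_X_add_C_eq_map_polyOfEsymm
    ((Ideal.Quotient.mkₐ ℂ (Iab N a b)).comp (rename Sum.inr)) b (fun i => by
      have h : rename Sum.inr (esymm (Fin N) ℂ ((i : ℕ) + 1)) - C (b i) ∈ Iab N a b :=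
        Ideal.subset_span ⟨i, Or.inr rfl⟩
      exact Ideal.Quotient.eq.2 h)
  simpa using this

theorem exists_relation_mem_of_prod_eq_map {N : ℕ} {σ : Type*} (I : Ideal (MvPolynomial σ ℂ))
    (e : Fin N → σ) (q : Polynomial ℂ)
    (hq : ∏ j, (Polynomial.X + Polynomial.C (Ideal.Quotient.mkₐ ℂ I (X (e j)))) =
      q.map (algebraMap ℂ (MvPolynomial σ ℂ ⧸ I))) (i : Fin N) :
    ∃ c : ℕ → MvPolynomial σ ℂ, (∀ t, c t ∈ supported ℂ (e '' Set.Ioi i)) ∧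
      X (e i) ^ ((i : ℕ) + 1) + ∑ t ∈ Finset.range ((i : ℕ) + 1), c t * X (e i) ^ t ∈ I := by
  obtain ⟨c, hc, hrel⟩ := exists_monic_relation_of_prod_eq_map _ q hq i
  have hlift : ∀ t, ∃ p ∈ supported ℂ (e '' Set.Ioi i), Ideal.Quotient.mkₐ ℂ I p = c t := by
    intro t
    have h := hc t
    have himg : (fun j => Ideal.Quotient.mkₐ ℂ I (X (e j))) '' Set.Ioi i =
        Ideal.Quotient.mkₐ ℂ I '' (X '' (e '' Set.Ioi i)) := by
      rw [Set.image_image, Set.image_image]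
    rw [himg, ← AlgHom.map_adjoin, ← supported_eq_adjoin_X] at h
    exact h
  choose p hp hpc using hlift
  refine ⟨p, hp, Ideal.Quotient.eq_zero_iff_mem.1 ?_⟩
  have : Ideal.Quotient.mkₐ ℂ I (X (e i) ^ ((i : ℕ) + 1) +
      ∑ t ∈ Finset.range ((i : ℕ) + 1), p t * X (e i) ^ t) = 0 := by
    rw [← hrel]
    simp only [map_add, map_sum, map_mul, map_pow, hpc]
  exact this

theorem exists_nondegenerate_functional {N : ℕ} (a b : Fin N → ℂ) :
    ∃ l : Rzl N →ₗ[ℂ] ℂ, (∀ x ∈ Iab N a b, l x = 0) ∧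
      (∀ τ x, l (permZ N τ x) = (Equiv.Perm.sign τ : ℤ) * l x) ∧
      (∀ τ x, l (permL N τ x) = (Equiv.Perm.sign τ : ℤ) * l x) ∧
      ∀ f ∉ Iab N a b, ∃ g, l (f * g) ≠ 0 := by
  classical
  obtain ⟨Da, Da_perm, Da_eq, Da_ne, Da_sum⟩ := exists_alternating_function a
  obtain ⟨Db, Db_perm, Db_eq, Db_ne, Db_sum⟩ := exists_alternating_function b
  let D : ((Fin N ⊕ Fin N) →₀ ℕ) → ℂ := fun m => Da (m ∘ Sum.inl) * Db (m ∘ Sum.inr)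
  let l : Rzl N →ₗ[ℂ] ℂ := (basisMonomials (Fin N ⊕ Fin N) ℂ).constr ℂ D
  have l_mon1 : ∀ m, l (monomial m 1) = D m := by
    intro m
    have := (basisMonomials (Fin N ⊕ Fin N) ℂ).constr_basis ℂ D m
    rwa [coe_basisMonomials] at this
  have l_mon : ∀ m c, l (monomial m c) = c * D m := by
    intro m c
    rw [← mul_one c, ← smul_eq_mul, ← smul_monomial, map_smul, l_mon1]
    simp
  have hI : ∀ x ∈ Iab N a b, l x = 0 := by
    suffices ∀ x ∈ Iab N a b, ∀ p, l (p * x) = 0 by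
      intro x hx
      simpa using this x hx 1
    intro x hx
    induction hx using Submodule.span_induction with
    | zero => simp
    | add x y _ _ h1 h2 => intro p; rw [mul_add, map_add, h1, h2, add_zero]
    | smul r x _ h => intro p; rw [smul_eq_mul, ← mul_assoc]; exact h _
    | mem x hx =>
      intro p
      obtain ⟨i, hx⟩ := hx
      induction p using MvPolynomial.induction_on' with
      | add p q hp hq => rw [add_mul, map_add, hp, hq, add_zero]
      | monomial m c =>
        rcases hx with rfl | rfl
        · rw [esymm_eq_sum_monomial, map_sum, mul_sub, Finset.mul_sum, map_sub, map_sum,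
            mul_comm _ (C (a i)), C_mul_monomial, l_mon, sub_eq_zero]
          simp_rw [rename_monomial, monomial_mul, l_mon, mul_one]
          rw [mul_assoc (a i), mul_left_comm, ← Finset.mul_sum]
          congr 1
          simp only [D]
          rw [← mul_assoc, ← Da_sum, Finset.sum_mul]
          refine Finset.sum_congr rfl fun S _ => ?_
          congr 2
          · funext j
            simp [Finsupp.mapDomain_finsetSum, Finsupp.mapDomain_single, Finsupp.single_apply]
          · funext j
            simp [Finsupp.mapDomain_finsetSum, Finsupp.mapDomain_single]
        · rw [esymm_eq_sum_monomial, map_sum, mul_sub, Finset.mul_sum, map_sub, map_sum,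
            mul_comm _ (C (b i)), C_mul_monomial, l_mon, sub_eq_zero]
          simp_rw [rename_monomial, monomial_mul, l_mon, mul_one]
          rw [mul_assoc (b i), mul_left_comm, ← Finset.mul_sum]
          congr 1
          simp only [D]
          rw [mul_left_comm, ← Db_sum, Finset.mul_sum]
          refine Finset.sum_congr rfl fun S _ => ?_
          congr 2
          · funext j
            simp [Finsupp.mapDomain_finsetSum, Finsupp.mapDomain_single]
          · funext j
            simp [Finsupp.mapDomain_finsetSum, Finsupp.mapDomain_single, Finsupp.single_apply]
  refine ⟨l, hI, ?_, ?_, ?_⟩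
  · intro τ x
    induction x using MvPolynomial.induction_on' with
    | add p q hp hq => rw [map_add, map_add, hp, hq, map_add, mul_add]
    | monomial m c =>
      rw [permZ, rename_monomial, l_mon, l_mon]
      have hinj : Function.Injective (Sum.map τ id : Fin N ⊕ Fin N → Fin N ⊕ Fin N) :=
        τ.injective.sumMap Function.injective_id
      have h1 : (m.mapDomain (Sum.map τ id)) ∘ Sum.inl = (m ∘ Sum.inl) ∘ ⇑τ⁻¹ := by
        funext j
        have := Finsupp.mapDomain_apply hinj m (Sum.inl (τ⁻¹ j))
        simpa using this
      have h2 : (m.mapDomain (Sum.map τ id)) ∘ Sum.inr = m ∘ Sum.inr := by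
        funext j
        have := Finsupp.mapDomain_apply hinj m (Sum.inr j)
        simpa using this
      simp only [D]
      rw [h1, h2, Da_perm, Equiv.Perm.sign_inv]
      ring
  · intro τ x
    induction x using MvPolynomial.induction_on' with
    | add p q hp hq => rw [map_add, map_add, hp, hq, map_add, mul_add]
    | monomial m c =>
      rw [permL, rename_monomial, l_mon, l_mon]
      have hinj : Function.Injective (Sum.map id τ : Fin N ⊕ Fin N → Fin N ⊕ Fin N) :=
        Function.injective_id.sumMap τ.injective
      have h1 : (m.mapDomain (Sum.map id τ)) ∘ Sum.inr = (m ∘ Sum.inr) ∘ ⇑τ⁻¹ := by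
        funext j
        have := Finsupp.mapDomain_apply hinj m (Sum.inr (τ⁻¹ j))
        simpa using this
      have h2 : (m.mapDomain (Sum.map id τ)) ∘ Sum.inl = m ∘ Sum.inl := by
        funext j
        have := Finsupp.mapDomain_apply hinj m (Sum.inl j)
        simpa using this
      simp only [D]
      rw [h1, h2, Db_perm, Equiv.Perm.sign_inv]
      ring
  · intro f hf
    let δ : (Fin N ⊕ Fin N) →₀ ℕ :=
      Finsupp.equivFunOnFinite.symm (Sum.elim (fun i => (i : ℕ)) (fun i => (i : ℕ)))
    refine exists_apply_mul_ne_zero_of_triangular (σ := Fin N ⊕ₗ Fin N) (Iab N a b) l δ hI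
      ?_ ?_ ?_ hf
    · exact (l_mon1 δ).trans_ne (mul_ne_zero Da_ne Db_ne)
    · intro γ i hγ hi
      refine (l_mon1 γ).trans ?_
      rcases i with i | i
      · have hi' : γ (Sum.inl i) < (i : ℕ) := hi
        have h1 : γ (Sum.inl ⟨γ (Sum.inl i), hi'.trans i.2⟩) = γ (Sum.inl i) :=
          hγ (Sum.inlₗ ⟨γ (Sum.inl i), hi'.trans i.2⟩) (Sum.Lex.inl hi')
        have h2 : Da (γ ∘ Sum.inl) = 0 :=
          Da_eq _ ⟨γ (Sum.inl i), hi'.trans i.2⟩ i (fun h => by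
            have := congrArg Fin.val h
            simp at this
            omega) h1
        exact mul_eq_zero_of_left h2 _
      · have hi' : γ (Sum.inr i) < (i : ℕ) := hi
        have h1 : γ (Sum.inr ⟨γ (Sum.inr i), hi'.trans i.2⟩) = γ (Sum.inr i) :=
          hγ (Sum.inrₗ ⟨γ (Sum.inr i), hi'.trans i.2⟩) (Sum.Lex.inr hi')
        have h2 : Db (γ ∘ Sum.inr) = 0 :=
          Db_eq _ ⟨γ (Sum.inr i), hi'.trans i.2⟩ i (fun h => by
            have := congrArg Fin.val h
            simp at this
            omega) h1
        exact mul_eq_zero_of_right _ h2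
    · intro i
      rcases i with i | i
      · obtain ⟨c, hc, hrel⟩ := exists_relation_mem_of_prod_eq_map (Iab N a b) Sum.inl _
          (mk_prod_X_add_C_inl a b) i
        refine ⟨c, fun t => supported_mono ?_ (hc t), hrel⟩
        rintro _ ⟨j, hj, rfl⟩
        exact Sum.Lex.inl hj
      · obtain ⟨c, hc, hrel⟩ := exists_relation_mem_of_prod_eq_map (Iab N a b) Sum.inr _
          (mk_prod_X_add_C_inr a b) i
        refine ⟨c, fun t => supported_mono ?_ (hc t), hrel⟩
        rintro _ ⟨j, hj, rfl⟩
        exact Sum.Lex.inr hj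

/-! ### Reducing polynomials to lower degree modulo an ideal -/

section LowDegree

variable {σ : Type*}

/-- The space of polynomials of total degree less than `n`. -/
def lowDegree (σ : Type*) (n : ℕ) : Submodule ℂ (MvPolynomial σ ℂ) :=
  restrictSupport ℂ {m | m.degree < n}

theorem lowDegree_mono {m n : ℕ} (h : m ≤ n) : lowDegree σ m ≤ lowDegree σ n :=
  restrictSupport_mono ℂ fun _ hx => lt_of_lt_of_le hx h

theorem lowDegree_zero : lowDegree σ 0 = ⊥ := by
  refine eq_bot_iff.2 fun x hx => ?_
  have hx := (mem_restrictSupport_iff ℂ).1 hx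
  refine (Submodule.mem_bot ℂ).2 (support_eq_empty.1 ?_)
  exact Finset.eq_empty_of_forall_notMem fun m hm => Nat.not_lt_zero _ (hx hm)

theorem mul_mem_lowDegree {m n : ℕ} {x y : MvPolynomial σ ℂ} (hx : x ∈ lowDegree σ m)
    (hy : y ∈ lowDegree σ (n + 1)) : x * y ∈ lowDegree σ (m + n) := by
  have h := Submodule.mul_mem_mul hx hy
  rw [lowDegree, lowDegree, ← restrictSupport_add] at h
  refine restrictSupport_mono ℂ ?_ h
  rintro _ ⟨a, ha, b, hb, rfl⟩
  have ha : a.degree < m := ha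
  have hb : b.degree < n + 1 := hb
  change (a + b).degree < m + n
  rw [map_add]
  omega

theorem X_mem_lowDegree (i : σ) : (X i : MvPolynomial σ ℂ) ∈ lowDegree σ 2 := by
  rw [lowDegree, X, monomial_mem_restrictSupport]
  simp

theorem X_pow_mem_lowDegree (i : σ) (k : ℕ) :
    (X i ^ k : MvPolynomial σ ℂ) ∈ lowDegree σ (k + 1) := by
  rw [lowDegree, X_pow_eq_monomial, monomial_mem_restrictSupport]
  simp

theorem C_mem_lowDegree (c : ℂ) : (C c : MvPolynomial σ ℂ) ∈ lowDegree σ 1 := by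
  rw [lowDegree, ← monomial_zero', monomial_mem_restrictSupport]
  simp

theorem rename_mem_lowDegree {τ : Type*} (f : σ → τ) {n : ℕ} {x : MvPolynomial σ ℂ}
    (hx : x ∈ lowDegree σ n) : rename f x ∈ lowDegree τ n := by
  rw [x.as_sum, map_sum]
  refine Submodule.sum_mem _ fun m hm => ?_
  rw [rename_monomial, lowDegree, monomial_mem_restrictSupport]
  left
  change (m.mapDomain f).degree < n
  rw [Finsupp.degree_mapDomain]
  exact ((mem_restrictSupport_iff ℂ).1 hx) hm

/-- The space of polynomials which agree modulo `I` with one of degree less than `n`. -/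
def lowDegreeMod (I : Ideal (MvPolynomial σ ℂ)) (n : ℕ) : Submodule ℂ (MvPolynomial σ ℂ) :=
  I.restrictScalars ℂ ⊔ lowDegree σ n

theorem lowDegreeMod_mono (I : Ideal (MvPolynomial σ ℂ)) {m n : ℕ} (h : m ≤ n) :
    lowDegreeMod I m ≤ lowDegreeMod I n :=
  sup_le_sup_left (lowDegree_mono h) _

theorem mul_mem_lowDegreeMod {I : Ideal (MvPolynomial σ ℂ)} {m n : ℕ} {x y : MvPolynomial σ ℂ}
    (hx : x ∈ lowDegreeMod I m) (hy : y ∈ lowDegree σ (n + 1)) :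
    x * y ∈ lowDegreeMod I (m + n) := by
  obtain ⟨a, ha, b, hb, rfl⟩ := Submodule.mem_sup.1 hx
  rw [add_mul]
  exact Submodule.add_mem_sup (I.mul_mem_right _ ha) (mul_mem_lowDegree hb hy)

theorem apply_eq_zero_of_mem_lowDegreeMod {I : Ideal (MvPolynomial σ ℂ)} {d : ℕ}
    (ψ : MvPolynomial σ ℂ →ₗ[ℂ] ℂ) (hI : ∀ x ∈ I, ψ x = 0) (hd : ∀ x ∈ lowDegree σ d, ψ x = 0)
    {x : MvPolynomial σ ℂ} (hx : x ∈ lowDegreeMod I d) : ψ x = 0 := by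
  obtain ⟨y, hy, z, hz, rfl⟩ := Submodule.mem_sup.1 hx
  rw [map_add, hI y hy, hd z hz, add_zero]

theorem coeff_prod_X_add_C_mem_lowDegree {ι : Type*} (e : ι → σ) (S : Finset ι) (t k : ℕ)
    (h : S.card < t + k) :
    (∏ j ∈ S, (Polynomial.X + Polynomial.C (X (e j) : MvPolynomial σ ℂ))).coeff t ∈
      lowDegree σ k := by
  classical
  induction S using Finset.induction_on generalizing t k with
  | empty =>
    rw [Finset.prod_empty, Polynomial.coeff_one]
    rw [Finset.card_empty] at h
    split_ifs with ht
    · exact lowDegree_mono (by omega) (C_mem_lowDegree 1)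
    · exact Submodule.zero_mem _
  | insert i S hi ih =>
    rw [Finset.card_insert_of_notMem hi] at h
    set p := ∏ j ∈ S, (Polynomial.X + Polynomial.C (X (e j) : MvPolynomial σ ℂ)) with hp
    have hmul : X (e i) * p.coeff t ∈ lowDegree σ k := by
      rcases k with _ | k
      · have h0 := ih t 0 (by omega)
        rw [lowDegree_zero, Submodule.mem_bot] at h0
        rw [h0, mul_zero]
        exact Submodule.zero_mem _
      · rw [mul_comm]
        exact mul_mem_lowDegree (ih t k (by omega)) (X_mem_lowDegree _)
    rw [Finset.prod_insert hi, add_mul, Polynomial.coeff_add, Polynomial.coeff_C_mul]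
    refine Submodule.add_mem _ ?_ hmul
    rcases t with _ | t
    · rw [Polynomial.coeff_X_mul_zero]
      exact Submodule.zero_mem _
    · rw [Polynomial.coeff_X_mul]
      exact ih t k (by omega)

theorem coeff_prod_univ_sub_C_mem
    {N : ℕ} (I : Ideal (MvPolynomial σ ℂ)) (e : Fin N → σ) (q : Polynomial ℂ)
    (hq : ∏ j, (Polynomial.X + Polynomial.C (Ideal.Quotient.mkₐ ℂ I (X (e j)))) =
      q.map (algebraMap ℂ (MvPolynomial σ ℂ ⧸ I))) (t : ℕ) :
    (∏ j, (Polynomial.X + Polynomial.C (X (e j) : MvPolynomial σ ℂ))).coeff t - C (q.coeff t) ∈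
      I := by
  have h := congrArg (fun p => Polynomial.coeff p t) hq
  have h2 := Polynomial.coeff_map (Ideal.Quotient.mkₐ ℂ I : MvPolynomial σ ℂ →+* MvPolynomial σ ℂ ⧸ I)
    (p := ∏ j, (Polynomial.X + Polynomial.C (X (e j) : MvPolynomial σ ℂ))) t
  rw [Polynomial.map_prod] at h2
  simp only [Polynomial.map_add, Polynomial.map_X, Polynomial.map_C, RingHom.coe_coe] at h2
  rw [h2, Polynomial.coeff_map] at h
  exact Ideal.Quotient.eq.1 h

theorem coeff_prod_univ_mem_lowDegreeMod
    {N : ℕ} (I : Ideal (MvPolynomial σ ℂ)) (e : Fin N → σ) (q : Polynomial ℂ)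
    (hq : ∏ j, (Polynomial.X + Polynomial.C (Ideal.Quotient.mkₐ ℂ I (X (e j)))) =
      q.map (algebraMap ℂ (MvPolynomial σ ℂ ⧸ I))) (t : ℕ) :
    (∏ j, (Polynomial.X + Polynomial.C (X (e j) : MvPolynomial σ ℂ))).coeff t ∈
      lowDegreeMod I 1 := by
  rw [← sub_add_cancel (Polynomial.coeff _ t) (C (q.coeff t))]
  exact Submodule.add_mem_sup (coeff_prod_univ_sub_C_mem I e q hq t) (C_mem_lowDegree _)

theorem coeff_prod_erase_sub_pow_mem_lowDegreeMod
    {N : ℕ} (I : Ideal (MvPolynomial σ ℂ)) (e : Fin N → σ) (q : Polynomial ℂ)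
    (hq : ∏ j, (Polynomial.X + Polynomial.C (Ideal.Quotient.mkₐ ℂ I (X (e j)))) =
      q.map (algebraMap ℂ (MvPolynomial σ ℂ ⧸ I))) (i : Fin N) (k : ℕ) (hk : k < N) :
    (∏ j ∈ Finset.univ.erase i,
      (Polynomial.X + Polynomial.C (X (e j) : MvPolynomial σ ℂ))).coeff (N - 1 - k) -
        (-X (e i)) ^ k ∈ lowDegreeMod I k := by
  classical
  set p := ∏ j ∈ Finset.univ.erase i,
    (Polynomial.X + Polynomial.C (X (e j) : MvPolynomial σ ℂ)) with hp
  induction k with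
  | zero =>
    have h1 : p.Monic := Polynomial.monic_prod_of_monic _ _ fun j _ => Polynomial.monic_X_add_C _
    have h2 : p.natDegree = N - 1 := by
      rw [hp, Polynomial.natDegree_prod_of_monic _ _ fun j _ => Polynomial.monic_X_add_C _]
      simp [Finset.card_erase_of_mem]
    have h3 := h1.coeff_natDegree
    rw [h2] at h3
    rw [Nat.sub_zero, h3, pow_zero, sub_self]
    exact Submodule.zero_mem _
  | succ k ih =>
    obtain ⟨t, ht⟩ : ∃ t, N - 1 - k = t + 1 := ⟨N - 1 - (k + 1), by omega⟩
    have ht' : N - 1 - (k + 1) = t := by omega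
    have h1 := Finset.mul_prod_erase Finset.univ
      (fun j => Polynomial.X + Polynomial.C (X (e j) : MvPolynomial σ ℂ)) (Finset.mem_univ i)
    have h2 := congrArg (fun p => Polynomial.coeff p (t + 1)) h1
    simp only [add_mul, Polynomial.coeff_add, Polynomial.coeff_X_mul, Polynomial.coeff_C_mul] at h2
    rw [ht'] at *
    rw [ht] at ih
    have h3 := Submodule.sub_mem _ (lowDegreeMod_mono I (by omega)
      (coeff_prod_univ_mem_lowDegreeMod I e q hq (t + 1)))
      (mul_mem_lowDegreeMod (ih (by omega)) (X_mem_lowDegree (e i)))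
    convert h3 using 1
    rw [← h2]
    ring

theorem X_pow_mem_lowDegreeMod
    {N : ℕ} (I : Ideal (MvPolynomial σ ℂ)) (e : Fin N → σ) (q : Polynomial ℂ)
    (hq : ∏ j, (Polynomial.X + Polynomial.C (Ideal.Quotient.mkₐ ℂ I (X (e j)))) =
      q.map (algebraMap ℂ (MvPolynomial σ ℂ ⧸ I))) (i : Fin N) (k : ℕ) (hk : N ≤ k) :
    (X (e i) : MvPolynomial σ ℂ) ^ k ∈ lowDegreeMod I k := by
  classical
  have hN : 0 < N := i.pos
  set p := ∏ j ∈ Finset.univ.erase i,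
    (Polynomial.X + Polynomial.C (X (e j) : MvPolynomial σ ℂ)) with hp
  have h1 := Finset.mul_prod_erase Finset.univ
    (fun j => Polynomial.X + Polynomial.C (X (e j) : MvPolynomial σ ℂ)) (Finset.mem_univ i)
  have h2 := congrArg (fun p => Polynomial.coeff p 0) h1
  simp only [add_mul, Polynomial.coeff_add, Polynomial.coeff_X_mul_zero, Polynomial.coeff_C_mul,
    zero_add] at h2
  have h3 := coeff_prod_erase_sub_pow_mem_lowDegreeMod I e q hq i (N - 1) (by omega)
  rw [Nat.sub_self, ← hp] at h3
  have h4 := Submodule.sub_mem _ (lowDegreeMod_mono I (by omega)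
      (coeff_prod_univ_mem_lowDegreeMod I e q hq 0))
      (mul_mem_lowDegreeMod h3 (X_mem_lowDegree (e i)))
  rw [← h2, ← hp] at h4
  have h5 : X (e i) * p.coeff 0 - (p.coeff 0 - (-X (e i)) ^ (N - 1)) * X (e i) =
      (-1 : ℂ) ^ (N - 1) • X (e i) ^ N := by
    rw [neg_pow, Algebra.smul_def]
    conv_rhs => rw [← Nat.sub_add_cancel hN, pow_succ]
    simp
    ring
  rw [h5, Nat.sub_add_cancel hN] at h4
  have h6 := (Submodule.smul_mem_iff _ (pow_ne_zero (N - 1) (by norm_num : (-1 : ℂ) ≠ 0))).1 h4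
  have h7 := mul_mem_lowDegreeMod h6 (X_pow_mem_lowDegree (e i) (k - N))
  rwa [← pow_add, Nat.add_sub_cancel' hk] at h7

end LowDegree

/-! ### Functionals annihilated by the Bethe algebra vanish -/

/-- The polynomial `∏_{j ∈ S} (x + z_j)`. -/
def prodZ {N : ℕ} (S : Finset (Fin N)) : Polynomial (Rzl N) :=
  ∏ j ∈ S, (Polynomial.X + Polynomial.C (X (Sum.inl j)))

/-- The polynomial `∏_{j ∈ S} (x + λ_j)`. -/
def prodL {N : ℕ} (S : Finset (Fin N)) : Polynomial (Rzl N) :=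
  ∏ j ∈ S, (Polynomial.X + Polynomial.C (X (Sum.inr j)))

theorem prod_X_add_C_eq_sum_coeff {N : ℕ} (e : Fin N → Fin N ⊕ Fin N) (S : Finset (Fin N)) (u : ℂ) :
    ∏ j ∈ S, (C u + X (e j) : Rzl N) =
      ∑ s : Fin (N + 1), u ^ (s : ℕ) •
        (∏ j ∈ S, (Polynomial.X + Polynomial.C (X (e j) : Rzl N))).coeff s := by
  set p : Polynomial (Rzl N) := ∏ j ∈ S, (Polynomial.X + Polynomial.C (X (e j) : Rzl N)) with hp
  have h1 : p.natDegree < N + 1 := by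
    rw [hp, Polynomial.natDegree_prod_of_monic _ _ fun j _ => Polynomial.monic_X_add_C _]
    have := Finset.card_le_univ S
    simp only [Polynomial.natDegree_X_add_C, Finset.sum_const, smul_eq_mul, mul_one]
    simpa [Nat.lt_succ_iff] using this
  have h2 : p.eval (C u) = ∏ j ∈ S, (C u + X (e j) : Rzl N) := by
    rw [hp, Polynomial.eval_prod]
    simp
  rw [← h2, Polynomial.eval_eq_sum_range' h1, Finset.sum_range]
  refine Finset.sum_congr rfl fun s _ => ?_
  rw [Algebra.smul_def, algebraMap_eq, map_pow, mul_comm]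

theorem prod_one_sub_eq_sum {N : ℕ} (F : Finset (Fin N)) (u v : ℂ) :
    ∏ i ∈ F, (1 - (C (-u) - X (Sum.inl i)) * (C (-v) - X (Sum.inr i)) : Rzl N) =
      ∑ s : Fin (N + 1), u ^ (s : ℕ) • ∑ t : Fin (N + 1), v ^ (t : ℕ) •
        ∑ S ∈ F.powerset, (-1 : ℂ) ^ S.card • ((prodZ S).coeff s * (prodL S).coeff t) := by
  have h1 : ∀ i ∈ F, (1 - (C (-u) - X (Sum.inl i)) * (C (-v) - X (Sum.inr i)) : Rzl N) =
      (-1 * ((C u + X (Sum.inl i)) * (C v + X (Sum.inr i)))) + 1 := by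
    intro i _
    simp only [map_neg]
    ring
  rw [Finset.prod_congr rfl h1, Finset.prod_add_one]
  simp_rw [Finset.smul_sum]
  have h2 : ∀ (f : Fin (N + 1) → Fin (N + 1) → Finset (Fin N) → Rzl N),
      ∑ s, ∑ t, ∑ S ∈ F.powerset, f s t S = ∑ S ∈ F.powerset, ∑ s, ∑ t, f s t S := by
    intro f
    symm
    rw [Finset.sum_comm]
    exact Finset.sum_congr rfl fun s _ => Finset.sum_comm
  rw [h2]
  refine Finset.sum_congr rfl fun S _ => ?_
  rw [Finset.prod_mul_distrib, Finset.prod_mul_distrib, Finset.prod_const,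
    prod_X_add_C_eq_sum_coeff Sum.inl, prod_X_add_C_eq_sum_coeff Sum.inr, Finset.sum_mul_sum,
    Finset.mul_sum]
  refine Finset.sum_congr rfl fun s _ => ?_
  rw [Finset.mul_sum]
  refine Finset.sum_congr rfl fun t _ => ?_
  rw [smul_mul_smul_comm, smul_smul, mul_smul_comm, prodZ, prodL]
  congr 1
  rw [Algebra.smul_def, map_pow, map_neg, map_one]


section Vanishing

variable {N : ℕ} {a b : Fin N → ℂ}

theorem sum_apply_coeff_mul_eq_zero (ψ : Rzl N →ₗ[ℂ] ℂ) (g : Rzl N)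
    (h : ∀ u v : ℂ, ∑ σ : Equiv.Perm (Fin N),
      ψ ((∏ i ∈ Finset.univ.filter (fun i => σ i = i),
        (1 - (C u - X (Sum.inl i)) * (C v - X (Sum.inr i)))) * permL N σ g) = 0)
    (s t : Fin (N + 1)) :
    ∑ σ : Equiv.Perm (Fin N), ∑ S ∈ (Finset.univ.filter (fun i => σ i = i)).powerset,
      (-1 : ℂ) ^ S.card * ψ ((prodZ S).coeff s * (prodL S).coeff t * permL N σ g) = 0 := by
  have key : ∀ u v : ℂ, ∑ s : Fin (N + 1), u ^ (s : ℕ) • ∑ t : Fin (N + 1), v ^ (t : ℕ) •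
      ∑ σ : Equiv.Perm (Fin N), ∑ S ∈ (Finset.univ.filter (fun i => σ i = i)).powerset,
        (-1 : ℂ) ^ S.card * ψ ((prodZ S).coeff s * (prodL S).coeff t * permL N σ g) = 0 := by
    intro u v
    rw [← h (-u) (-v)]
    simp_rw [prod_one_sub_eq_sum, Finset.sum_mul, map_sum, smul_mul_assoc, map_smul,
      Finset.sum_mul, map_sum, smul_mul_assoc, map_smul, Finset.sum_mul, map_sum, smul_mul_assoc,
      map_smul, smul_eq_mul]
    rw [Finset.sum_comm]
    refine Finset.sum_congr rfl fun s _ => ?_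
    rw [← Finset.mul_sum, Finset.sum_comm]
    congr 1
    refine Finset.sum_congr rfl fun t _ => ?_
    rw [← Finset.mul_sum]
  have h1 := fun v s => (⊥ : Submodule ℂ ℂ).mem_of_forall_sum_pow_smul_mem _
    (fun u => (Submodule.mem_bot ℂ).2 (key u v)) s
  have h2 := (⊥ : Submodule ℂ ℂ).mem_of_forall_sum_pow_smul_mem _ (fun v => h1 v s) t
  exact (Submodule.mem_bot ℂ).1 h2

theorem sum_apply_pow_mul_pow_mul_eq_zero (ψ : Rzl N →ₗ[ℂ] ℂ) (hI : ∀ x ∈ Iab N a b, ψ x = 0)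
    (d e k l : ℕ) (hd : ∀ x ∈ lowDegree _ d, ψ x = 0) (g : Rzl N) (hg : g ∈ lowDegree _ (e + 1))
    (hekl : k + l + e ≤ d) (hk : k < N) (hl : l < N) (hψg : ψ g = 0)
    (h : ∀ u v : ℂ, ∑ σ : Equiv.Perm (Fin N),
      ψ ((∏ i ∈ Finset.univ.filter (fun i => σ i = i),
        (1 - (C u - X (Sum.inl i)) * (C v - X (Sum.inr i)))) * permL N σ g) = 0) :
    ∑ i, ψ (X (Sum.inl i) ^ k * X (Sum.inr i) ^ l * g) = 0 := by
  classical
  have hN : 0 < N := by omega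
  have hmod := fun x => apply_eq_zero_of_mem_lowDegreeMod ψ hI hd (x := x)
  have h0 := sum_apply_coeff_mul_eq_zero ψ g h ⟨N - 1 - k, by omega⟩ ⟨N - 1 - l, by omega⟩
  simp only at h0
  have hsmall : ∀ (S : Finset (Fin N)) (σ : Equiv.Perm (Fin N)), S.card + 1 < N →
      ψ ((prodZ S).coeff (N - 1 - k) * (prodL S).coeff (N - 1 - l) * permL N σ g) = 0 := by
    intro S σ hS
    refine hd _ (lowDegree_mono hekl (mul_mem_lowDegree (mul_mem_lowDegree ?_ ?_)
      (rename_mem_lowDegree _ hg)))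
    · exact coeff_prod_X_add_C_mem_lowDegree _ _ _ _ (by omega)
    · exact coeff_prod_X_add_C_mem_lowDegree _ _ _ _ (by omega)
  rw [Finset.sum_eq_single 1] at h0
  rotate_left
  · intro σ _ hσ
    refine Finset.sum_eq_zero fun S hS => ?_
    rw [hsmall, mul_zero]
    have h1 := Equiv.Perm.two_le_card_support_of_ne_one hσ
    have h2 : S.card ≤ σ.supportᶜ.card := Finset.card_le_card fun i hi => by
      have := Finset.mem_powerset.1 hS hi
      simpa using this
    rw [Finset.card_compl, Fintype.card_fin] at h2
    have h3 := Finset.card_le_univ σ.support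
    rw [Fintype.card_fin] at h3
    omega
  · intro h
    exact absurd (Finset.mem_univ _) h
  have hone : permL N 1 g = g := permL_one g
  simp only [Equiv.Perm.coe_one, id, Finset.filter_true, Finset.powerset_univ, hone] at h0
  have hsub : insert Finset.univ (Finset.univ.image fun i : Fin N => Finset.univ.erase i) ⊆
      (Finset.univ : Finset (Finset (Fin N))) := Finset.subset_univ _
  rw [← Finset.sum_subset hsub] at h0
  rotate_left
  · intro S _ hS
    have h1 := hsmall S 1
    rw [hone] at h1
    rw [h1, mul_zero]
    by_contra hcon
    apply hS
    have h2 : Sᶜ.card ≤ 1 := by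
      rw [Finset.card_compl, Fintype.card_fin]
      omega
    rcases Nat.le_one_iff_eq_zero_or_eq_one.1 h2 with h2 | h2
    · rw [Finset.card_eq_zero, Finset.compl_eq_empty_iff] at h2
      simp [h2]
    · obtain ⟨i, hi⟩ := Finset.card_eq_one.1 h2
      rw [compl_eq_comm] at hi
      rw [← hi]
      simp [Finset.compl_singleton]
  rw [Finset.sum_insert (by simp [Finset.erase_eq_self]), Finset.sum_image (by
    intro i _ j _ hij
    by_contra hne
    have : i ∈ Finset.univ.erase j := Finset.mem_erase.2 ⟨hne, Finset.mem_univ _⟩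
    have hij : Finset.univ.erase i = Finset.univ.erase j := hij
    rw [← hij] at this
    simp at this)] at h0
  have huniv : ψ ((prodZ Finset.univ).coeff (N - 1 - k) * (prodL Finset.univ).coeff (N - 1 - l) * g)
      = 0 := by
    set x := (prodZ (Finset.univ : Finset (Fin N))).coeff (N - 1 - k)
    set y := (prodL (Finset.univ : Finset (Fin N))).coeff (N - 1 - l)
    set c := (polyOfEsymm a).coeff (N - 1 - k)
    set c' := (polyOfEsymm b).coeff (N - 1 - l)
    have hx : x - C c ∈ Iab N a b :=
      coeff_prod_univ_sub_C_mem _ _ _ (mk_prod_X_add_C_inl a b) _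
    have hy : y - C c' ∈ Iab N a b :=
      coeff_prod_univ_sub_C_mem _ _ _ (mk_prod_X_add_C_inr a b) _
    have h1 : x * y * g = (x - C c) * (y * g) + (y - C c') * (C c * g) + (c * c') • g := by
      rw [Algebra.smul_def, algebraMap_eq, map_mul]
      ring
    rw [h1, map_add, map_add, hI _ (Ideal.mul_mem_right _ _ hx),
      hI _ (Ideal.mul_mem_right _ _ hy), map_smul, hψg]
    simp
  have herase : ∀ i, ψ ((prodZ (Finset.univ.erase i)).coeff (N - 1 - k) *
      (prodL (Finset.univ.erase i)).coeff (N - 1 - l) * g) =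
      (-1) ^ (k + l) * ψ (X (Sum.inl i) ^ k * X (Sum.inr i) ^ l * g) := by
    intro i
    set x := (prodZ (Finset.univ.erase i)).coeff (N - 1 - k)
    set y := (prodL (Finset.univ.erase i)).coeff (N - 1 - l)
    have hx : x - (-X (Sum.inl i)) ^ k ∈ lowDegreeMod (Iab N a b) k :=
      coeff_prod_erase_sub_pow_mem_lowDegreeMod _ _ _ (mk_prod_X_add_C_inl a b) i k hk
    have hy : y - (-X (Sum.inr i)) ^ l ∈ lowDegreeMod (Iab N a b) l :=
      coeff_prod_erase_sub_pow_mem_lowDegreeMod _ _ _ (mk_prod_X_add_C_inr a b) i l hl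
    have hy' : y ∈ lowDegree _ (l + 1) := by
      refine coeff_prod_X_add_C_mem_lowDegree _ _ _ _ ?_
      rw [Finset.card_erase_of_mem (Finset.mem_univ _), Finset.card_univ, Fintype.card_fin]
      omega
    have h1 : x * y * g = (x - (-X (Sum.inl i)) ^ k) * y * g +
        (y - (-X (Sum.inr i)) ^ l) * X (Sum.inl i) ^ k * ((-1 : ℂ) ^ k • g) +
        ((-1 : ℂ) ^ (k + l)) • (X (Sum.inl i) ^ k * X (Sum.inr i) ^ l * g) := by
      rw [Algebra.smul_def, Algebra.smul_def, neg_pow (X (Sum.inl i) : Rzl N),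
        neg_pow (X (Sum.inr i) : Rzl N)]
      simp only [map_pow, map_neg, map_one]
      ring
    rw [h1, map_add, map_add, map_smul, hmod, hmod, smul_eq_mul, zero_add, zero_add]
    · refine lowDegreeMod_mono _ (by omega : l + k + e ≤ d) (mul_mem_lowDegreeMod
        (mul_mem_lowDegreeMod hy (X_pow_mem_lowDegree _ _)) (Submodule.smul_mem _ _ hg))
    · exact lowDegreeMod_mono _ hekl (mul_mem_lowDegreeMod (mul_mem_lowDegreeMod hx hy') hg)
  rw [huniv, mul_zero, zero_add] at h0
  simp_rw [herase, Finset.card_erase_of_mem (Finset.mem_univ _), ← mul_assoc] at h0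
  rw [← Finset.mul_sum] at h0
  refine (mul_eq_zero.1 h0).resolve_left (mul_ne_zero ?_ ?_)
  all_goals exact pow_ne_zero _ (by norm_num)

/-- The indices `i` such that `z_i` or `λ_i` occurs in the monomial with exponent `m`. -/
def pairSupport (m : (Fin N ⊕ Fin N) →₀ ℕ) : Finset (Fin N) :=
  Finset.univ.filter fun i => m (Sum.inl i) ≠ 0 ∨ m (Sum.inr i) ≠ 0

theorem apply_inl_eq_zero_of_notMem_pairSupport {m : (Fin N ⊕ Fin N) →₀ ℕ} {i : Fin N}
    (h : i ∉ pairSupport m) : m (Sum.inl i) = 0 := by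
  simp only [pairSupport, Finset.mem_filter, Finset.mem_univ, true_and] at h
  omega

theorem apply_inr_eq_zero_of_notMem_pairSupport {m : (Fin N ⊕ Fin N) →₀ ℕ} {i : Fin N}
    (h : i ∉ pairSupport m) : m (Sum.inr i) = 0 := by
  simp only [pairSupport, Finset.mem_filter, Finset.mem_univ, true_and] at h
  omega

theorem permZ_permL_eq_rename (σ : Equiv.Perm (Fin N)) (x : Rzl N) :
    permZ N σ (permL N σ x) = rename (Sum.map σ σ) x := by
  rw [permZ, permL, rename_rename, Sum.map_comp_map, Function.comp_id, Function.id_comp]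

theorem rename_swap_monomial_eq_self {m : (Fin N ⊕ Fin N) →₀ ℕ} {i j : Fin N}
    (hi : i ∉ pairSupport m) (hj : j ∉ pairSupport m) :
    rename (Sum.map (Equiv.swap i j) (Equiv.swap i j)) (monomial m (1 : ℂ)) = monomial m 1 := by
  suffices m.mapDomain (Sum.map (Equiv.swap i j) (Equiv.swap i j)) = m by
    rw [rename_monomial, this]
  refine (Finsupp.mapDomain_congr fun x hx => ?_).trans Finsupp.mapDomain_id
  rw [Finsupp.mem_support_iff] at hx
  rcases x with x | x
  · have h1 : x ≠ i := fun h => hx (h ▸ apply_inl_eq_zero_of_notMem_pairSupport hi)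
    have h2 : x ≠ j := fun h => hx (h ▸ apply_inl_eq_zero_of_notMem_pairSupport hj)
    simp [Equiv.swap_apply_of_ne_of_ne h1 h2]
  · have h1 : x ≠ i := fun h => hx (h ▸ apply_inr_eq_zero_of_notMem_pairSupport hi)
    have h2 : x ≠ j := fun h => hx (h ▸ apply_inr_eq_zero_of_notMem_pairSupport hj)
    simp [Equiv.swap_apply_of_ne_of_ne h1 h2]

theorem apply_monomial_eq_zero (ψ : Rzl N →ₗ[ℂ] ℂ) (hI : ∀ x ∈ Iab N a b, ψ x = 0)
    (hsym : ∀ σ x, ψ (permZ N σ (permL N σ x)) = ψ x)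
    (hker : ∀ g, ψ g = 0 → ∀ u v : ℂ, ∑ σ : Equiv.Perm (Fin N),
      ψ ((∏ i ∈ Finset.univ.filter (fun i => σ i = i),
        (1 - (C u - X (Sum.inl i)) * (C v - X (Sum.inr i)))) * permL N σ g) = 0)
    (hone : ψ 1 = 0) (d : ℕ) (hd : ∀ x ∈ lowDegree _ d, ψ x = 0) (n : ℕ)
    (m : (Fin N ⊕ Fin N) →₀ ℕ) (hm : m.degree ≤ d) (hn : (pairSupport m).card = n) :
    ψ (monomial m 1) = 0 := by
  classical
  have hmod := fun x => apply_eq_zero_of_mem_lowDegreeMod ψ hI hd (x := x)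
  induction n using Nat.strong_induction_on generalizing m with
  | _ n ih =>
  rcases (pairSupport m).eq_empty_or_nonempty with h0 | ⟨i, hi⟩
  · have : m = 0 := by
      ext x
      rcases x with x | x
      · exact apply_inl_eq_zero_of_notMem_pairSupport (h0 ▸ Finset.notMem_empty x)
      · exact apply_inr_eq_zero_of_notMem_pairSupport (h0 ▸ Finset.notMem_empty x)
    rw [this]
    exact hone
  set k := m (Sum.inl i) with hk
  set l := m (Sum.inr i) with hl
  set m' := (m.erase (Sum.inl i)).erase (Sum.inr i) with hm'
  have hmm : m = m' + Finsupp.single (Sum.inl i) k + Finsupp.single (Sum.inr i) l := by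
    rw [hm', add_right_comm, hl, ← Finsupp.erase_ne (f := m) (a := Sum.inl i) (by simp : Sum.inr i ≠ Sum.inl i),
      Finsupp.erase_add_single, hk, Finsupp.erase_add_single]
  have hkl : 0 < k + l := by
    simp only [pairSupport, Finset.mem_filter, Finset.mem_univ, true_and] at hi
    omega
  set e := m'.degree with he
  have hdeg : e + k + l ≤ d := by
    rw [hmm] at hm
    simpa using hm
  have him' : i ∉ pairSupport m' := by
    simp [pairSupport, hm', Finsupp.erase_ne]
  have hmon : ∀ j, (monomial (m' + Finsupp.single (Sum.inl j) k + Finsupp.single (Sum.inr j) l) 1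
      : Rzl N) = X (Sum.inl j) ^ k * X (Sum.inr j) ^ l * monomial m' 1 := by
    intro j
    rw [X_pow_eq_monomial, X_pow_eq_monomial, monomial_mul, monomial_mul, mul_one, mul_one,
      add_assoc, add_comm m']
  have hgmem : ∀ n, e < n → (monomial m' 1 : Rzl N) ∈ lowDegree _ n := by
    intro n hn
    rw [lowDegree, monomial_mem_restrictSupport]
    exact Or.inl hn
  by_cases hkN : N ≤ k
  · rw [hmm, hmon]
    have h1 := X_pow_mem_lowDegreeMod _ _ _ (mk_prod_X_add_C_inl a b) i k hkN
    refine hmod _ (lowDegreeMod_mono _ (by omega : k + l + e ≤ d) (mul_mem_lowDegreeMod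
      (mul_mem_lowDegreeMod h1 (X_pow_mem_lowDegree _ _)) (hgmem _ (by omega))))
  by_cases hlN : N ≤ l
  · rw [hmm, hmon, mul_comm (X (Sum.inl i) ^ k)]
    have h1 := X_pow_mem_lowDegreeMod _ _ _ (mk_prod_X_add_C_inr a b) i l hlN
    refine hmod _ (lowDegreeMod_mono _ (by omega : l + k + e ≤ d) (mul_mem_lowDegreeMod
      (mul_mem_lowDegreeMod h1 (X_pow_mem_lowDegree _ _)) (hgmem _ (by omega))))
  have hg0 : ψ (monomial m' 1) = 0 := hd _ (hgmem d (by omega))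
  have hsum := sum_apply_pow_mul_pow_mul_eq_zero ψ hI d e k l hd (monomial m' 1)
    (hgmem _ (by omega)) (by omega) (by omega) (by omega) hg0 (hker _ hg0)
  have hterm : ∀ j, ψ (X (Sum.inl j) ^ k * X (Sum.inr j) ^ l * monomial m' 1) =
      if j ∈ pairSupport m' then 0 else ψ (monomial m 1) := by
    intro j
    split_ifs with hj
    · rw [← hmon]
      refine ih _ ?_ _ ?_ rfl
      · rw [← hn]
        refine Finset.card_lt_card ((Finset.ssubset_iff_of_subset fun x hx => ?_).2
          ⟨i, hi, fun hcon => ?_⟩)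
        · by_contra hxm
          have hxi : x ≠ i := fun h => hxm (h ▸ hi)
          have hxj : x ≠ j := by
            rintro rfl
            have h1 := apply_inl_eq_zero_of_notMem_pairSupport hxm
            have h2 := apply_inr_eq_zero_of_notMem_pairSupport hxm
            simp [pairSupport, hm', Finsupp.erase_apply, h1, h2] at hj
          have h1 := apply_inl_eq_zero_of_notMem_pairSupport hxm
          have h2 := apply_inr_eq_zero_of_notMem_pairSupport hxm
          simp [pairSupport, hm', Finsupp.erase_apply, h1, h2, Finsupp.single_apply, hxj.symm] at hx
        · have hij : j ≠ i := fun h => him' (h ▸ hj)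
          simp [pairSupport, hm', Finsupp.erase_apply, Finsupp.single_apply, hij] at hcon
      · simpa using hdeg
    · rw [← hsym (Equiv.swap i j) (monomial m 1), permZ_permL_eq_rename, hmm, hmon,
        map_mul (rename _),
        rename_swap_monomial_eq_self him' hj]
      simp
  simp_rw [hterm] at hsum
  rw [Finset.sum_ite, Finset.sum_const_zero, zero_add, Finset.sum_const, smul_eq_zero] at hsum
  refine hsum.resolve_left fun hcard => ?_
  rw [Finset.card_eq_zero] at hcard
  exact Finset.notMem_empty i (hcard ▸ Finset.mem_filter.2 ⟨Finset.mem_univ i, him'⟩)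

theorem eq_zero_of_annihilated (ψ : Rzl N →ₗ[ℂ] ℂ) (hI : ∀ x ∈ Iab N a b, ψ x = 0)
    (hsym : ∀ σ x, ψ (permZ N σ (permL N σ x)) = ψ x)
    (hker : ∀ g, ψ g = 0 → ∀ u v : ℂ, ∑ σ : Equiv.Perm (Fin N),
      ψ ((∏ i ∈ Finset.univ.filter (fun i => σ i = i),
        (1 - (C u - X (Sum.inl i)) * (C v - X (Sum.inr i)))) * permL N σ g) = 0)
    (hone : ψ 1 = 0) : ψ = 0 := by
  have hd : ∀ d, ∀ x ∈ lowDegree _ d, ψ x = 0 := by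
    intro d
    induction d with
    | zero =>
      intro x hx
      rw [lowDegree_zero, Submodule.mem_bot] at hx
      rw [hx, map_zero]
    | succ d ih =>
      intro x hx
      rw [x.as_sum, map_sum]
      refine Finset.sum_eq_zero fun m hm => ?_
      have hdeg : m.degree < d + 1 := ((mem_restrictSupport_iff ℂ).1 hx) hm
      rw [← mul_one (x.coeff m), ← smul_eq_mul, ← smul_monomial, map_smul,
        apply_monomial_eq_zero ψ hI hsym hker hone d ih _ m (by omega) rfl, smul_zero]
  refine (basisMonomials _ ℂ).ext fun m => ?_
  rw [coe_basisMonomials, LinearMap.zero_apply]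
  refine hd (m.degree + 1) (monomial m 1) ?_
  rw [lowDegree, monomial_mem_restrictSupport]
  exact Or.inl (Nat.lt_succ_self _)

end Vanishing

/-! ### The Bethe operators on the invariant space -/

section Bethe

variable {N : ℕ}

theorem permL_mul (σ τ : Equiv.Perm (Fin N)) (x : Rzl N) :
    permL N (σ * τ) x = permL N σ (permL N τ x) := by
  rw [permL, permL, permL, rename_rename, Sum.map_comp_map, Function.comp_id, Equiv.Perm.coe_mul]

theorem permZ_mul (σ τ : Equiv.Perm (Fin N)) (x : Rzl N) :
    permZ N (σ * τ) x = permZ N σ (permZ N τ x) := by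
  rw [permZ, permZ, permZ, rename_rename, Sum.map_comp_map, Function.comp_id, Equiv.Perm.coe_mul]

theorem permZ_one (x : Rzl N) : permZ N 1 x = x := by
  rw [permZ, Equiv.Perm.coe_one, Sum.map_id_id, rename_id_apply]

theorem TL_apply_s18 (i j : Fin N) (F : V1 N) (ρ : Equiv.Perm (Fin N)) :
    TL N i j F ρ = permL N (Equiv.swap i j) (F (Equiv.swap i j * ρ)) := rfl

theorem TR_apply_s18 (i j : Fin N) (F : V1 N) (ρ : Equiv.Perm (Fin N)) :
    TR N i j F ρ = permZ N (Equiv.swap i j) (F (ρ * Equiv.swap i j)) := rfl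

theorem mem_V1SL_iff {F : V1 N} :
    F ∈ V1SL N ↔ ∀ s ρ : Equiv.Perm (Fin N), F (s * ρ) = permL N s (F ρ) := by
  constructor
  · intro h s
    have hlt : ∀ i j : Fin N, i < j → ∀ ρ, F (Equiv.swap i j * ρ) =
        permL N (Equiv.swap i j) (F ρ) := by
      intro i j hij ρ
      conv_rhs => rw [← h i j hij, TL_apply_s18, ← permL_mul, Equiv.swap_mul_self, permL_one]
    induction s using Equiv.Perm.swap_induction_on with
    | one => intro ρ; rw [one_mul, permL_one]
    | swap_mul f x y hxy ih =>
      intro ρ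
      rw [permL_mul, ← ih, mul_assoc]
      rcases lt_or_gt_of_ne hxy with h1 | h1
      · exact hlt x y h1 _
      · rw [Equiv.swap_comm]
        exact hlt y x h1 _
  · intro h i j _
    funext ρ
    rw [TL_apply_s18, h, ← permL_mul, Equiv.swap_mul_self, permL_one]

theorem mem_V1SR_iff {F : V1 N} :
    F ∈ V1SR N ↔ ∀ s ρ : Equiv.Perm (Fin N), F (ρ * s⁻¹) = permZ N s (F ρ) := by
  constructor
  · intro h s
    have hlt : ∀ i j : Fin N, i < j → ∀ ρ, F (ρ * Equiv.swap i j) =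
        permZ N (Equiv.swap i j) (F ρ) := by
      intro i j hij ρ
      conv_rhs => rw [← h i j hij, TR_apply_s18, ← permZ_mul, Equiv.swap_mul_self, permZ_one]
    induction s using Equiv.Perm.swap_induction_on with
    | one => intro ρ; rw [inv_one, mul_one, permZ_one]
    | swap_mul f x y hxy ih =>
      intro ρ
      rw [permZ_mul, ← ih, mul_inv_rev, ← mul_assoc, Equiv.swap_inv]
      rcases lt_or_gt_of_ne hxy with h1 | h1
      · exact hlt x y h1 _
      · rw [Equiv.swap_comm]
        exact hlt y x h1 _
  · intro h i j _
    funext ρ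
    have := h (Equiv.swap i j) ρ
    rw [Equiv.swap_inv] at this
    rw [TR_apply_s18, this, ← permZ_mul, Equiv.swap_mul_self, permZ_one]

/-- The diagonal factor of `P^B(u,v)` at `σ` and `τ`. -/
def fixFactor (u v : ℂ) (σ τ : Equiv.Perm (Fin N)) : Rzl N :=
  ∏ i ∈ Finset.univ.filter (fun i => σ i = i),
    (1 - (C u - X (Sum.inl (τ⁻¹ i))) * (C v - X (Sum.inr i)))

theorem fixFactor_inv_mul (u v : ℂ) (σ ρ : Equiv.Perm (Fin N)) :
    fixFactor u v σ (σ⁻¹ * ρ) = fixFactor u v σ ρ := by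
  refine Finset.prod_congr rfl fun i hi => ?_
  have hi : σ i = i := (Finset.mem_filter.1 hi).2
  rw [mul_inv_rev, inv_inv, Equiv.Perm.mul_apply, hi]

theorem PB_apply_s18 (u v : ℂ) (F : V1 N) (ρ : Equiv.Perm (Fin N)) :
    PB N u v F ρ = (-1 : ℤ) ^ N • ∑ σ : Equiv.Perm (Fin N), (Equiv.Perm.sign σ : ℤ) •
      (fixFactor u v σ ρ * F (σ⁻¹ * ρ)) := by
  simp_rw [← fixFactor_inv_mul u v _ ρ]
  rw [PB, LinearMap.smul_apply, LinearMap.sum_apply, Pi.smul_apply, Finset.sum_apply]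
  rfl

theorem permL_fixFactor (u v : ℂ) (s σ ρ : Equiv.Perm (Fin N)) :
    permL N s (fixFactor u v σ ρ) = fixFactor u v (s * σ * s⁻¹) (s * ρ) := by
  rw [fixFactor, map_prod, fixFactor]
  refine Finset.prod_equiv s (fun i => ?_) fun i _ => ?_
  · have h : (s * σ * s⁻¹) (s i) = s i ↔ σ i = i := by simp
    exact ⟨fun hi => Finset.mem_filter.2 ⟨Finset.mem_univ _, h.2 (Finset.mem_filter.1 hi).2⟩,
      fun hi => Finset.mem_filter.2 ⟨Finset.mem_univ _, h.1 (Finset.mem_filter.1 hi).2⟩⟩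
  · simp [permL]

theorem permZ_fixFactor (u v : ℂ) (s σ ρ : Equiv.Perm (Fin N)) :
    permZ N s (fixFactor u v σ ρ) = fixFactor u v σ (ρ * s⁻¹) := by
  rw [fixFactor, map_prod, fixFactor]
  refine Finset.prod_congr rfl fun i _ => ?_
  simp [permZ]

theorem PB_mem_WW (u v : ℂ) {F : V1 N} (hF : F ∈ WW N) : PB N u v F ∈ WW N := by
  have hL := mem_V1SL_iff.1 hF.1
  have hR := mem_V1SR_iff.1 hF.2
  refine ⟨mem_V1SL_iff.2 fun s ρ => ?_, mem_V1SR_iff.2 fun s ρ => ?_⟩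
  · rw [PB_apply_s18, PB_apply_s18, map_zsmul, map_sum, ← Equiv.sum_comp (MulAut.conj s).toEquiv]
    congr 1
    refine Finset.sum_congr rfl fun σ _ => ?_
    rw [map_zsmul, map_mul, permL_fixFactor, ← hL]
    have h1 : (MulAut.conj s).toEquiv σ = s * σ * s⁻¹ := rfl
    have h2 : (s * σ * s⁻¹)⁻¹ * (s * ρ) = s * (σ⁻¹ * ρ) := by group
    rw [h1, h2, Equiv.Perm.sign_mul, Equiv.Perm.sign_mul, mul_right_comm, ← Equiv.Perm.sign_mul,
      mul_inv_cancel, Equiv.Perm.sign_one, one_mul]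
  · rw [PB_apply_s18, PB_apply_s18, map_zsmul, map_sum]
    congr 1
    refine Finset.sum_congr rfl fun σ _ => ?_
    rw [map_zsmul, map_mul, permZ_fixFactor, ← hR, mul_assoc]

theorem PB_mem_IV (u v : ℂ) {a b : Fin N → ℂ} {F : V1 N} (hF : F ∈ IV N a b) :
    PB N u v F ∈ IV N a b := by
  intro ρ
  rw [PB_apply_s18]
  exact zsmul_mem (sum_mem fun σ _ => zsmul_mem (Ideal.mul_mem_left _ _ (hF _)) _) _

/-- `W` as a subspace of `V_1`. -/
def invariantSubmodule (N : ℕ) : Submodule ℂ (V1 N) where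
  carrier := WW N
  add_mem' hF hG := ⟨fun i j h => by rw [map_add, hF.1 i j h, hG.1 i j h],
    fun i j h => by rw [map_add, hF.2 i j h, hG.2 i j h]⟩
  zero_mem' := ⟨fun _ _ _ => map_zero _, fun _ _ _ => map_zero _⟩
  smul_mem' c _ hF := ⟨fun i j h => by rw [map_smul, hF.1 i j h],
    fun i j h => by rw [map_smul, hF.2 i j h]⟩

/-- `I_{a,b}·V_1` as a subspace of `V_1`. -/
def idealSubmodule (N : ℕ) (a b : Fin N → ℂ) : Submodule ℂ (V1 N) where
  carrier := IV N a b
  add_mem' hF hG τ := add_mem (hF τ) (hG τ)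
  zero_mem' _ := zero_mem _
  smul_mem' c _ hF τ := ((Iab N a b).restrictScalars ℂ).smul_mem c (hF τ)

theorem permL_mem_Iab {a b : Fin N → ℂ} (τ : Equiv.Perm (Fin N)) {x : Rzl N}
    (hx : x ∈ Iab N a b) : permL N τ x ∈ Iab N a b := by
  have h : Iab N a b ≤ (Iab N a b).comap (permL N τ) := by
    rw [Iab, Ideal.span_le]
    rintro _ ⟨i, rfl | rfl⟩
    · refine Ideal.subset_span ⟨i, Or.inl ?_⟩
      rw [map_sub, permL, rename_rename, rename_C]
      rfl
    · refine Ideal.subset_span ⟨i, Or.inr ?_⟩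
      have h1 : (Sum.map id τ : Fin N ⊕ Fin N → Fin N ⊕ Fin N) ∘ Sum.inr = Sum.inr ∘ τ := rfl
      rw [map_sub, permL, rename_rename, rename_C, h1, ← rename_rename, rename_esymm]
  exact h hx

theorem mem_IV_of_apply_one_mem {a b : Fin N → ℂ} {F : V1 N} (hF : F ∈ WW N)
    (h : F 1 ∈ Iab N a b) : F ∈ IV N a b := by
  intro τ
  rw [← mul_one τ, mem_V1SL_iff.1 hF.1]
  exact permL_mem_Iab τ h

theorem sum_apply_fixFactor_mul (l : Rzl N →ₗ[ℂ] ℂ)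
    (hl : ∀ τ x, l (permL N τ x) = (Equiv.Perm.sign τ : ℤ) * l x) {F : V1 N} (hF : F ∈ WW N)
    (g : Rzl N) (u v : ℂ) :
    ∑ σ : Equiv.Perm (Fin N), l (F 1 * (fixFactor u v σ 1 * permL N σ g)) =
      (-1) ^ N * l (PB N u v F 1 * g) := by
  rw [PB_apply_s18, zsmul_eq_mul, mul_assoc, Finset.sum_mul]
  have h1 : ∀ x : Rzl N, l ((((-1 : ℤ) ^ N : ℤ) : Rzl N) * x) = (-1) ^ N * l x := by
    intro x
    rw [← zsmul_eq_mul, map_zsmul, zsmul_eq_mul]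
    push_cast
    rfl
  rw [h1, ← mul_assoc, ← mul_pow, map_sum]
  rw [neg_one_mul, neg_neg, one_pow, one_mul]
  refine Finset.sum_congr rfl fun σ _ => ?_
  have h2 : fixFactor u v σ σ = fixFactor u v σ 1 := by
    rw [← fixFactor_inv_mul u v σ σ, inv_mul_cancel]
  rw [mul_one, smul_mul_assoc, map_zsmul, zsmul_eq_mul, ← hl, map_mul (permL N σ),
    map_mul (permL N σ), permL_fixFactor,
    ← mem_V1SL_iff.1 hF.1, mul_inv_cancel_right, mul_inv_cancel, mul_one, h2, mul_left_comm,
    mul_assoc]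

theorem mem_IV_of_eigenvector {a b : Fin N → ℂ} (l : Rzl N →ₗ[ℂ] ℂ)
    (hI : ∀ x ∈ Iab N a b, l x = 0)
    (hlZ : ∀ τ x, l (permZ N τ x) = (Equiv.Perm.sign τ : ℤ) * l x)
    (hlL : ∀ τ x, l (permL N τ x) = (Equiv.Perm.sign τ : ℤ) * l x)
    (hnd : ∀ f ∉ Iab N a b, ∃ g, l (f * g) ≠ 0) {F : V1 N} (hF : F ∈ WW N)
    (hPB : ∀ u v : ℂ, ∃ c : ℂ, PB N u v F - c • F ∈ IV N a b) (h1 : l (F 1) = 0) :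
    F ∈ IV N a b := by
  refine mem_IV_of_apply_one_mem hF (by_contra fun hcon => ?_)
  obtain ⟨g, hg⟩ := hnd _ hcon
  have h0 : l ∘ₗ LinearMap.mulLeft ℂ (F 1) = 0 := by
    refine eq_zero_of_annihilated (a := a) (b := b) _ (fun x hx => ?_) (fun σ x => ?_)
      (fun g hg u v => ?_) ?_
    · exact hI _ (Ideal.mul_mem_left _ _ hx)
    · have hinv : permZ N σ (permL N σ (F 1)) = F 1 := by
        rw [← mem_V1SL_iff.1 hF.1, ← mem_V1SR_iff.1 hF.2]
        simp
      rw [LinearMap.comp_apply, LinearMap.comp_apply, LinearMap.mulLeft_apply,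
        LinearMap.mulLeft_apply]
      conv_lhs => rw [← hinv, ← map_mul, ← map_mul, hlZ, hlL, ← mul_assoc]
      rw [← Int.cast_mul, ← Units.val_mul, Int.units_mul_self]
      simp
    · obtain ⟨c, hc⟩ := hPB u v
      have h2 := hI _ (Ideal.mul_mem_right g _ (hc 1))
      rw [Pi.sub_apply, Pi.smul_apply, sub_mul, map_sub, smul_mul_assoc, map_smul,
        sub_eq_zero] at h2
      have hg : l (F 1 * g) = 0 := hg
      refine (sum_apply_fixFactor_mul l hlL hF g u v).trans ?_
      rw [h2, hg, smul_zero, mul_zero]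
    · simpa using h1
  exact hg (LinearMap.congr_fun h0 g)

end Bethe

set_option synthInstance.maxHeartbeats 1000000 in
/-- The operators `b̄_ij` preserve `W` and `I_{a,b}·V_1 ∩ W`, hence act on the quotient
`M_{a,b} = W/(I_{a,b}·V_1 ∩ W)`; joint eigenvectors of the Bethe algebra in `M_{a,b}`
with equal eigenvalues are proportional. -/
theorem stmt18 (N : ℕ) (hN : 0 < N)
    (bb : Fin (N + 1) → Fin (N + 1) → Module.End ℂ (V1 N))
    (hb : ∀ u v : ℂ, PB N u v =
      ∑ i : Fin (N + 1), ∑ j : Fin (N + 1),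
        (u ^ (N - (i : ℕ)) * v ^ (N - (j : ℕ))) • bb i j) :
    (∀ (i j : Fin (N + 1)) (F : V1 N), F ∈ WW N → bb i j F ∈ WW N) ∧
    ∀ a b : Fin N → ℂ,
      (∀ (i j : Fin (N + 1)) (F : V1 N),
        F ∈ IV N a b ∩ WW N → bb i j F ∈ IV N a b ∩ WW N) ∧
      ∀ v w : V1 N, v ∈ WW N → w ∈ WW N → v ∉ IV N a b → w ∉ IV N a b →
        ∀ β : Fin (N + 1) → Fin (N + 1) → ℂ,
          (∀ i j : Fin (N + 1), bb i j v - β i j • v ∈ IV N a b) →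
          (∀ i j : Fin (N + 1), bb i j w - β i j • w ∈ IV N a b) →
          ∃ c : ℂ, c ≠ 0 ∧ w - c • v ∈ IV N a b := by
  have hPBsum : ∀ (u v : ℂ) (F : V1 N), PB N u v F = ∑ i : Fin (N + 1), ∑ j : Fin (N + 1),
      (u ^ (N - (i : ℕ)) * v ^ (N - (j : ℕ))) • bb i j F := by
    intro u v F
    simp [hb, LinearMap.sum_apply]
  have hWW : ∀ (i j : Fin (N + 1)) (F : V1 N), F ∈ WW N → bb i j F ∈ WW N := fun i j F hF =>
    (invariantSubmodule N).mem_of_forall_sum_sum_pow_smul_mem (fun i j => bb i j F)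
      (fun u v => hPBsum u v F ▸ PB_mem_WW u v hF) i j
  refine ⟨hWW, fun a b => ⟨fun i j F hF => ⟨?_, hWW i j F hF.2⟩, ?_⟩⟩
  · exact (idealSubmodule N a b).mem_of_forall_sum_sum_pow_smul_mem (fun i j => bb i j F)
      (fun u v => hPBsum u v F ▸ PB_mem_IV u v hF.1) i j
  · intro v w hv hw hv0 hw0 β hβv hβw
    obtain ⟨l, hI, hlZ, hlL, hnd⟩ := exists_nondegenerate_functional a b
    have hmem : ∀ F ∈ WW N, (∀ i j, bb i j F - β i j • F ∈ IV N a b) → l (F 1) = 0 →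
        F ∈ IV N a b := by
      intro F hF hβ
      refine mem_IV_of_eigenvector l hI hlZ hlL hnd hF fun x y =>
        ⟨∑ i : Fin (N + 1), ∑ j : Fin (N + 1), x ^ (N - (i : ℕ)) * y ^ (N - (j : ℕ)) * β i j, ?_⟩
      rw [hPBsum, Finset.sum_smul, ← Finset.sum_sub_distrib]
      refine (idealSubmodule N a b).sum_mem fun i _ => ?_
      rw [Finset.sum_smul, ← Finset.sum_sub_distrib]
      refine (idealSubmodule N a b).sum_mem fun j _ => ?_
      rw [mul_smul _ (β i j), ← smul_sub]
      exact (idealSubmodule N a b).smul_mem _ (hβ i j)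
    have hlv : l (v 1) ≠ 0 := fun h => hv0 (hmem v hv hβv h)
    have hlw : l (w 1) ≠ 0 := fun h => hw0 (hmem w hw hβw h)
    refine ⟨l (w 1) / l (v 1), div_ne_zero hlw hlv, hmem _ ?_ (fun i j => ?_) ?_⟩
    · exact (invariantSubmodule N).sub_mem hw ((invariantSubmodule N).smul_mem _ hv)
    · have h : bb i j w - β i j • w - (l (w 1) / l (v 1)) • (bb i j v - β i j • v) ∈ IV N a b :=
        (idealSubmodule N a b).sub_mem (hβw i j) ((idealSubmodule N a b).smul_mem _ (hβv i j))
      rwa [smul_sub, sub_sub_sub_comm, smul_comm _ (β i j), ← smul_sub, ← map_smul, ← map_sub] at h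
    · rw [Pi.sub_apply, Pi.smul_apply, map_sub, map_smul, smul_eq_mul, div_mul_cancel₀ _ hlv,
        sub_self]
end
end
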